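/- arXiv:1712.00716 — 3 statements merged into one kernel-verified Lean document; each statement's English description precedes it below -/
import Mathlib

section
/- Let x ∈ ℂ^n with ‖x‖ = 1 and let ρ ∈ (0,1). With probability at least 1 − exp(−ρ⁴ m / (2 ‖C_x‖²)) over a ∼ CN(0, I_m), every subset S ⊆ {1,…,m} with |S| ≥ ρ m satisfies ‖(A x) ∘ 1_S‖ > (ρ^{3/2}/32) · ‖A x‖, where 1_S ∈ {0,1}^m is the indicator vector of S. -/
open MeasureTheory ProbabilityTheory Matrix Complex
open scoped NNReal ENNReal

noncomputable section

namespace ConvPR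

/-- The complex Gaussian distribution `CN(0, σ²)` on `ℂ`, as the pushforward of the
product of two real Gaussians `N(0, σ²/2)` under `(u, v) ↦ u + i v`. -/
def cgaussian (σ2 : ℝ) : Measure ℂ :=
  Measure.map (fun p : ℝ × ℝ => (p.1 : ℂ) + (p.2 : ℂ) * Complex.I)
    ((gaussianReal 0 (σ2 / 2).toNNReal).prod (gaussianReal 0 (σ2 / 2).toNNReal))

/-- The complex Gaussian `CN(0, σ² I_m)` on `Fin m → ℂ`. -/
def cgaussianVec (m : ℕ) (σ2 : ℝ) : Measure (Fin m → ℂ) :=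
  Measure.pi fun _ => cgaussian σ2

/-- The Euclidean norm on `Fin k → ℂ`. -/
def cnorm {k : ℕ} (v : Fin k → ℂ) : ℝ := Real.sqrt (∑ i, ‖v i‖ ^ 2)

/-- The Euclidean norm on `Fin k → ℝ`. -/
def rnorm {k : ℕ} (v : Fin k → ℝ) : ℝ := Real.sqrt (∑ i, v i ^ 2)

/-- The operator (spectral) norm of a complex matrix. -/
def opNorm {k l : ℕ} (M : Matrix (Fin k) (Fin l) ℂ) : ℝ :=
  sSup {r : ℝ | ∃ v : Fin l → ℂ, cnorm v ≤ 1 ∧ r = cnorm (M.mulVec v)}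

/-- Zero-padding `ℂ^n → ℂ^m`. -/
def pad {n : ℕ} (m : ℕ) (x : Fin n → ℂ) : Fin m → ℂ :=
  fun i => if hi : (i : ℕ) < n then x ⟨(i : ℕ), hi⟩ else 0

/-- The `m × n` matrix `A` formed by the first `n` columns of the circulant matrix `C_a`,
so that `A x = a ⊛ x`. -/
def Amat {n m : ℕ} (h : n ≤ m) (a : Fin m → ℂ) : Matrix (Fin m) (Fin n) ℂ :=
  Matrix.of fun i j => Matrix.circulant a i (Fin.castLE h j)

/-- The circulant matrix `C_x` generated by the zero-padding of `x`. -/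
def Cx {n : ℕ} (m : ℕ) (x : Fin n → ℂ) : Matrix (Fin m) (Fin m) ℂ :=
  Matrix.circulant (pad m x)

/-- `exp (i φ(u)) = u / |u|` for `u ≠ 0`, and `1` for `u = 0`. -/
def phase (u : ℂ) : ℂ := if u = 0 then 1 else u / (‖u‖ : ℂ)

/-- `ζ_{σ²}(t) = 1 − exp (−|t|² / (2σ²))`. -/
def zeta (σ2 : ℝ) (t : ℂ) : ℝ := 1 - Real.exp (-‖t‖ ^ 2 / (2 * σ2))

/-- `dist (z, X)` where `X = { x e^{iθ} : θ ∈ [0, 2π) }`. -/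
def distX {n : ℕ} (x z : Fin n → ℂ) : ℝ :=
  sInf {r : ℝ | ∃ θ ∈ Set.Ico (0 : ℝ) (2 * Real.pi),
    r = cnorm (z - Complex.exp ((θ : ℂ) * Complex.I) • x)}

/-- `y = |A x|`. -/
def yvec {n m : ℕ} (h : n ≤ m) (x : Fin n → ℂ) (a : Fin m → ℂ) : Fin m → ℝ :=
  fun k => ‖(Amat h a).mulVec x k‖

/-- The Hermitian inner product `x^* z`. -/
def dotc {n : ℕ} (x z : Fin n → ℂ) : ℂ := ∑ i, starRingEnd ℂ (x i) * z i

/-- `ψ(t) = exp (−2 i φ(t))`. -/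
def psi (t : ℂ) : ℂ := starRingEnd ℂ (phase t) ^ 2

/-- The Gaussian smoothing `h(t) = E_{s ∼ CN(0,1)} [ψ(t+s)]`. -/
def hfun (t : ℂ) : ℂ := ∫ s, psi (t + s) ∂(cgaussian 1)

/-- `Δ_∞(ε) = (1 + 2σ²) · sup_t |(1+ε) h(t) − ζ_{σ²}(t) ψ(t)|`. -/
def DeltaInf (σ2 ε : ℝ) : ℝ :=
  (1 + 2 * σ2) *
    sSup {r : ℝ | ∃ t : ℂ, r = ‖((1 + ε : ℝ) : ℂ) * hfun t - ((zeta σ2 t : ℝ) : ℂ) * psi t‖}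

/-- The generalized (Wirtinger) gradient of the weighted amplitude objective. -/
def grad {n m : ℕ} (h : n ≤ m) (σ2 : ℝ) (x : Fin n → ℂ) (a : Fin m → ℂ)
    (z : Fin n → ℂ) : Fin n → ℂ :=
  ((1 / (m : ℝ) : ℝ) : ℂ) •
    (Amat h a)ᴴ.mulVec fun k =>
      ((zeta σ2 ((yvec h x a k : ℝ) : ℂ) : ℝ) : ℂ) *
        ((Amat h a).mulVec z k - ((yvec h x a k : ℝ) : ℂ) * phase ((Amat h a).mulVec z k))

/-- The spectral-method matrix `Y = (1/m) A^* diag(y²) A`. -/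
def Ymat {n m : ℕ} (h : n ≤ m) (x : Fin n → ℂ) (a : Fin m → ℂ) :
    Matrix (Fin n) (Fin n) ℂ :=
  ((1 / (m : ℝ) : ℝ) : ℂ) •
    ((Amat h a)ᴴ * Matrix.diagonal (fun k => ((yvec h x a k ^ 2 : ℝ) : ℂ)) * Amat h a)

/-- The norm estimate `λ = sqrt((1/m) ∑ y_k²)`. -/
def lam {n m : ℕ} (h : n ≤ m) (x : Fin n → ℂ) (a : Fin m → ℂ) : ℝ :=
  Real.sqrt ((1 / (m : ℝ)) * ∑ k, yvec h x a k ^ 2)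

/-- `v` is a unit-norm eigenvector of `Y` associated with its largest eigenvalue. -/
def IsTopEigenvector {n : ℕ} (Y : Matrix (Fin n) (Fin n) ℂ) (v : Fin n → ℂ) : Prop :=
  cnorm v = 1 ∧ ∃ μ : ℝ, Y.mulVec v = (μ : ℂ) • v ∧
    ∀ μ' : ℝ, (∃ w : Fin n → ℂ, w ≠ 0 ∧ Y.mulVec w = (μ' : ℂ) • w) → μ' ≤ μ

/-- `M = ((2σ²+1)/m) A^* diag(ζ_{σ²}(y)) A`. -/
def Mmat {n m : ℕ} (h : n ≤ m) (σ2 : ℝ) (x : Fin n → ℂ) (a : Fin m → ℂ) :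
    Matrix (Fin n) (Fin n) ℂ :=
  (((2 * σ2 + 1) / (m : ℝ) : ℝ) : ℂ) •
    ((Amat h a)ᴴ *
      Matrix.diagonal (fun k => ((zeta σ2 ((yvec h x a k : ℝ) : ℂ) : ℝ) : ℂ)) * Amat h a)

/-- The vector `d(z)` from the contraction analysis. -/
def dvec {n m : ℕ} (h : n ≤ m) (σ2 : ℝ) (x : Fin n → ℂ) (a : Fin m → ℂ)
    (z : Fin n → ℂ) (θ : ℝ) : Fin n → ℂ :=
  (1 - Mmat h σ2 x a).mulVec (z - Complex.exp ((θ : ℂ) * Complex.I) • x)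
    - Complex.exp ((θ : ℂ) * Complex.I) • (Mmat h σ2 x a).mulVec x
    + (((2 * σ2 + 1) / (m : ℝ) : ℝ) : ℂ) •
        (Amat h a)ᴴ.mulVec fun k =>
          ((zeta σ2 ((yvec h x a k : ℝ) : ℂ) : ℝ) : ℂ) *
            (((yvec h x a k : ℝ) : ℂ) * phase ((Amat h a).mulVec z k))

/-- Projection onto the orthogonal complement of a unit vector `x`. -/
def projPerp {n : ℕ} (x v : Fin n → ℂ) : Fin n → ℂ := v - dotc x v • x

/-- Projection onto the span of a unit vector `x`. -/
def projPar {n : ℕ} (x v : Fin n → ℂ) : Fin n → ℂ := dotc x v • x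

/-- The matrix `P_{x⊥} = I − x x^*`. -/
def Pperp {n : ℕ} (x : Fin n → ℂ) : Matrix (Fin n) (Fin n) ℂ :=
  1 - Matrix.vecMulVec x (star x)

/-- `T = (1/m) R_{[1:n]} C_g^* diag(b) C_g R_{[1:n]}ᵀ`. -/
def Tmat {n m : ℕ} (h : n ≤ m) (b : Fin m → ℝ) (g : Fin m → ℂ) :
    Matrix (Fin n) (Fin n) ℂ :=
  ((1 / (m : ℝ) : ℝ) : ℂ) •
    (((Matrix.circulant g)ᴴ * Matrix.diagonal (fun k => ((b k : ℝ) : ℂ)) *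
        Matrix.circulant g).submatrix (Fin.castLE h) (Fin.castLE h))

/-- `L(g) = ‖T − (1/m)(∑ b_k) I‖`. -/
def Lfun {n m : ℕ} (h : n ≤ m) (b : Fin m → ℝ) (g : Fin m → ℂ) : ℝ :=
  opNorm (Tmat h b g -
    (((1 / (m : ℝ)) * ∑ k, b k : ℝ) : ℂ) • (1 : Matrix (Fin n) (Fin n) ℂ))

/-- `G = R_{[1:n]} C_g^*`. -/
def Gmat {n m : ℕ} (h : n ≤ m) (g : Fin m → ℂ) : Matrix (Fin n) (Fin m) ℂ :=
  ((Matrix.circulant g)ᴴ).submatrix (Fin.castLE h) id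

/-- `ξ_{σ²}(t) = (1/(2πσ²)) exp(−|t|²/(2σ²))`. -/
def xiF (σ2 : ℝ) (t : ℂ) : ℝ :=
  (1 / (2 * Real.pi * σ2)) * Real.exp (-‖t‖ ^ 2 / (2 * σ2))

/-- `ζ_{σ²}(t) = 1 − 2πσ² ξ_{σ²}(t)`. -/
def zetaF (σ2 : ℝ) (t : ℂ) : ℝ := 1 - 2 * Real.pi * σ2 * xiF σ2 t

/-- `η_{σ²}(t) = 1 − 2πσ² ξ_{σ²−1/2}(t)`. -/
def etaF (σ2 : ℝ) (t : ℂ) : ℝ := 1 - 2 * Real.pi * σ2 * xiF (σ2 - 1 / 2) t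

/-- `ν_{σ²}(t) = 1 − (4πσ⁴/(2σ²−1)) ξ_{σ²−1/2}(t)`. -/
def nuF (σ2 : ℝ) (t : ℂ) : ℝ :=
  1 - (4 * Real.pi * σ2 ^ 2 / (2 * σ2 - 1)) * xiF (σ2 - 1 / 2) t

/-- `g(t) = E_{v₁,v₂ ∼ N(0,1/2)} [((|t|+v₁)² − v₂²)/((|t|+v₁)² + v₂²)]`. -/
def gfun (t : ℂ) : ℝ :=
  ∫ p : ℝ × ℝ, ((‖t‖ + p.1) ^ 2 - p.2 ^ 2) / ((‖t‖ + p.1) ^ 2 + p.2 ^ 2)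
    ∂((gaussianReal 0 (1 / 2 : ℝ≥0)).prod (gaussianReal 0 (1 / 2 : ℝ≥0)))

section Calculus

variable {E : Type*} [NormedAddCommGroup E] [NormedSpace ℝ E]

lemma hasDerivAt_rotation_fst (x y : E) (θ : ℝ) :
    HasDerivAt (fun t : ℝ => Real.cos t • x + Real.sin t • y)
      (-Real.sin θ • x + Real.cos θ • y) θ :=
  ((Real.hasDerivAt_cos θ).smul_const x).add ((Real.hasDerivAt_sin θ).smul_const y)

lemma hasDerivAt_rotation_snd (x y : E) (θ : ℝ) :
    HasDerivAt (fun t : ℝ => -Real.sin t • x + Real.cos t • y)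
      (-(Real.cos θ • x + Real.sin θ • y)) θ := by
  rw [neg_add, ← neg_smul, ← neg_smul]
  exact ((Real.hasDerivAt_sin θ).neg.smul_const x).add ((Real.hasDerivAt_cos θ).smul_const y)

lemma norm_rotation_fst_le (x y : E) (θ : ℝ) :
    ‖Real.cos θ • x + Real.sin θ • y‖ ≤ ‖x‖ + ‖y‖ := by
  refine (norm_add_le _ _).trans (add_le_add ?_ ?_) <;> rw [norm_smul] <;>
    refine mul_le_of_le_one_left (norm_nonneg _) ?_
  · exact Real.abs_cos_le_one θ
  · exact Real.abs_sin_le_one θ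

lemma norm_rotation_snd_le (x y : E) (θ : ℝ) :
    ‖-Real.sin θ • x + Real.cos θ • y‖ ≤ ‖x‖ + ‖y‖ := by
  refine (norm_add_le _ _).trans (add_le_add ?_ ?_) <;> rw [norm_smul] <;>
    refine mul_le_of_le_one_left (norm_nonneg _) ?_
  · rw [norm_neg]; exact Real.abs_sin_le_one θ
  · exact Real.abs_cos_le_one θ

lemma fderiv_exp_mul {F : E → ℝ} (hF : ContDiff ℝ 1 F) (t : ℝ) (x : E) :
    fderiv ℝ (fun x => Real.exp (t * F x)) x = (t * Real.exp (t * F x)) • fderiv ℝ F x := by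
  have h := ((hF.differentiable one_ne_zero x).hasFDerivAt.const_mul t).exp.fderiv
  rw [h, smul_smul, mul_comm]

end Calculus

section Arctan

lemma abs_arctan_le_abs (v : ℝ) : |Real.arctan v| ≤ |v| := by
  have h := (convex_univ (𝕜 := ℝ) (E := ℝ)).norm_image_sub_le_of_norm_deriv_le (𝕜 := ℝ)
    (f := Real.arctan) (C := 1) (x := 0) (y := v)
    (fun x _ => Real.differentiable_arctan x) (fun x _ => ?_) trivial trivial
  · simpa using h
  · rw [Real.deriv_arctan, Real.norm_of_nonneg (by positivity), div_le_one (by positivity)]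
    linarith [sq_nonneg x]

lemma tendsto_mul_arctan_div (u : ℝ) :
    Filter.Tendsto (fun n : ℕ => (n + 1 : ℝ) * Real.arctan (u / (n + 1))) Filter.atTop
      (nhds u) := by
  have h : HasDerivAt (fun t : ℝ => Real.arctan (t * u)) u 0 := by
    simpa using ((hasDerivAt_id' (0 : ℝ)).mul_const u).arctan
  have h2 := h.tendsto_slope_zero.comp (tendsto_one_div_add_atTop_nhds_zero_nat (𝕜 := ℝ)
    |> fun h => tendsto_nhdsWithin_iff.2 ⟨h, Filter.Eventually.of_forall fun n => by
      simpa using (by positivity : (n + 1 : ℝ) ≠ 0)⟩)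
  refine h2.congr fun n => ?_
  simp [div_eq_inv_mul]

end Arctan

lemma integrable_exp_mul_of_abs_le {E : Type*} [TopologicalSpace E] [MeasurableSpace E]
    [OpensMeasurableSpace E] {μ : Measure E} [IsFiniteMeasure μ] {F : E → ℝ}
    (hF : Continuous F) {B : ℝ}
    (hB : ∀ x, |F x| ≤ B)
    (t : ℝ) : Integrable (fun x => Real.exp (t * F x)) μ := by
  refine (integrable_const (Real.exp (|t| * B))).mono'
    (Continuous.aestronglyMeasurable (by fun_prop)) (Filter.Eventually.of_forall fun x => ?_)
  rw [Real.norm_of_nonneg (Real.exp_pos _).le]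
  refine Real.exp_le_exp.2 ((le_abs_self _).trans ?_)
  rw [abs_mul]
  exact mul_le_mul_of_nonneg_left (hB x) (abs_nonneg _)

section GaussianConcentration

variable {E : Type*} [NormedAddCommGroup E] [NormedSpace ℝ E] [MeasurableSpace E] [BorelSpace E]
  [SecondCountableTopology E] [CompleteSpace E] {μ : Measure E} [IsGaussian μ]

/-- The rotated pair `(cos θ x + sin θ y, -sin θ x + cos θ y)` has the same law as `(x, y)`. -/
lemma integral_prod_rotation (hμ : ∫ x, x ∂μ = 0) (θ : ℝ) {g : E × E → ℝ} (hg : Continuous g) :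
    ∫ p, g (Real.cos θ • p.1 + Real.sin θ • p.2, -Real.sin θ • p.1 + Real.cos θ • p.2)
      ∂(μ.prod μ) = ∫ p, g p ∂(μ.prod μ) := by
  conv_rhs => rw [← IsGaussian.map_rotation_eq_self (μ := μ) hμ θ]
  rw [integral_map (by fun_prop) hg.aestronglyMeasurable]
  simp only [ContinuousLinearMap.rotation_apply]

lemma integrable_norm_add_norm :
    Integrable (fun p : E × E => ‖p.1‖ + ‖p.2‖) (μ.prod μ) := by
  have h : Integrable (fun x : E => ‖x‖) μ := (IsGaussian.integrable_id (μ := μ)).norm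
  exact (h.comp_fst μ).add (h.comp_snd μ)

lemma integrable_norm_add_norm_sq :
    Integrable (fun p : E × E => (‖p.1‖ + ‖p.2‖) ^ 2) (μ.prod μ) := by
  have h : MemLp (fun x : E => ‖x‖) 2 μ := (IsGaussian.memLp_two_id (μ := μ)).norm
  have := (h.comp_fst μ).add (h.comp_snd μ)
  exact this.integrable_sq

/-- Gaussian integration by parts for a centered Gaussian measure. -/
lemma integral_clm_mul_eq (hμ : ∫ x, x ∂μ = 0) {G : E → ℝ} (hG : ContDiff ℝ 1 G) {B K : ℝ}
    (hB : ∀ x, |G x| ≤ B) (hK : ∀ x, ‖fderiv ℝ G x‖ ≤ K) (ℓ : E →L[ℝ] ℝ) :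
    ∫ y, ℓ y * G y ∂μ = ∫ x, ∫ y, ℓ y * fderiv ℝ G x y ∂μ ∂μ := by
  have hB0 : 0 ≤ B := (abs_nonneg _).trans (hB 0)
  have hK0 : 0 ≤ K := (norm_nonneg _).trans (hK 0)
  have hGc := hG.continuous
  have hG' : Continuous (fderiv ℝ G) := hG.continuous_fderiv one_ne_zero
  have hcomp : Continuous fun p : E × E => fderiv ℝ G p.1 p.2 := by fun_prop
  have hconst (θ : ℝ) : ∫ p : E × E, G (Real.cos θ • p.1 + Real.sin θ • p.2) *
      ℓ (-Real.sin θ • p.1 + Real.cos θ • p.2) ∂(μ.prod μ)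
      = ∫ p : E × E, G p.1 * ℓ p.2 ∂(μ.prod μ) :=
    integral_prod_rotation hμ θ (g := fun p => G p.1 * ℓ p.2) (by fun_prop)
  have hder := (hasDerivAt_integral_of_dominated_loc_of_deriv_le (μ := μ.prod μ) (x₀ := (0 : ℝ))
    (F := fun θ p => G (Real.cos θ • p.1 + Real.sin θ • p.2) *
      ℓ (-Real.sin θ • p.1 + Real.cos θ • p.2))
    (F' := fun θ p => fderiv ℝ G (Real.cos θ • p.1 + Real.sin θ • p.2)
        (-Real.sin θ • p.1 + Real.cos θ • p.2) * ℓ (-Real.sin θ • p.1 + Real.cos θ • p.2) +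
        G (Real.cos θ • p.1 + Real.sin θ • p.2) * ℓ (-(Real.cos θ • p.1 + Real.sin θ • p.2)))
    (bound := fun p => K * ‖ℓ‖ * (‖p.1‖ + ‖p.2‖) ^ 2 + B * ‖ℓ‖ * (‖p.1‖ + ‖p.2‖))
    Filter.univ_mem
    (Filter.Eventually.of_forall fun θ => Continuous.aestronglyMeasurable (by fun_prop))
    ?_ (Continuous.aestronglyMeasurable ?_) (Filter.Eventually.of_forall fun p θ _ => ?_)
    ((integrable_norm_add_norm_sq.const_mul _).add (integrable_norm_add_norm.const_mul _))
    (Filter.Eventually.of_forall fun p θ _ => ?_)).2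
  · simp_rw [hconst] at hder
    have h0 := hder.unique (hasDerivAt_const (0 : ℝ) _)
    simp only [Real.cos_zero, Real.sin_zero, one_smul, zero_smul, add_zero, neg_zero, zero_add,
      map_neg, mul_neg] at h0
    have hI1 : Integrable (fun p : E × E => fderiv ℝ G p.1 p.2 * ℓ p.2) (μ.prod μ) := by
      refine (integrable_norm_add_norm_sq.const_mul (K * ‖ℓ‖)).mono'
        (Continuous.aestronglyMeasurable (by fun_prop)) (Filter.Eventually.of_forall fun p => ?_)
      rw [norm_mul]
      have h1 := (fderiv ℝ G p.1).le_of_opNorm_le (hK p.1) p.2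
      have h2 := ℓ.le_opNorm p.2
      calc _ ≤ (K * ‖p.2‖) * (‖ℓ‖ * ‖p.2‖) := by gcongr
        _ = K * ‖ℓ‖ * (0 + ‖p.2‖) ^ 2 := by ring
        _ ≤ _ := by gcongr; exact norm_nonneg _
    have hI2' : Integrable (fun x => G x * ℓ x) μ := by
      refine ((IsGaussian.integrable_id (μ := μ)).norm.const_mul (B * ‖ℓ‖)).mono'
        (Continuous.aestronglyMeasurable (by fun_prop)) (Filter.Eventually.of_forall fun p => ?_)
      rw [norm_mul, mul_assoc]
      exact mul_le_mul (hB p) (ℓ.le_opNorm p) (norm_nonneg _) hB0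
    have hI2 : Integrable (fun p : E × E => -(G p.1 * ℓ p.1)) (μ.prod μ) := (hI2'.comp_fst μ).neg
    rw [integral_add hI1 hI2, integral_neg, integral_prod _ hI1,
      integral_fun_fst (fun x => G x * ℓ x)] at h0
    simp only [probReal_univ, one_smul] at h0
    simp_rw [mul_comm (ℓ _)]
    linarith
  · refine (integrable_norm_add_norm.const_mul (B * ‖ℓ‖)).mono'
      (Continuous.aestronglyMeasurable (by fun_prop)) (Filter.Eventually.of_forall fun p => ?_)
    rw [norm_mul, mul_assoc]
    refine mul_le_mul (hB _) ((ℓ.le_opNorm _).trans ?_) (norm_nonneg _) hB0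
    gcongr
    exact norm_rotation_snd_le _ _ _
  · fun_prop
  · have h1 := norm_rotation_fst_le p.1 p.2 θ
    have h2 := norm_rotation_snd_le p.1 p.2 θ
    set u := Real.cos θ • p.1 + Real.sin θ • p.2
    set v := -Real.sin θ • p.1 + Real.cos θ • p.2
    have h3 := (fderiv ℝ G u).le_of_opNorm_le (hK u) v
    have h4 := ℓ.le_opNorm v
    have h5 : ‖ℓ (-u)‖ ≤ ‖ℓ‖ * ‖u‖ := by simpa using ℓ.le_opNorm (-u)
    have h6 : ‖G u‖ ≤ B := hB u
    calc _ ≤ ‖fderiv ℝ G u v‖ * ‖ℓ v‖ + ‖G u‖ * ‖ℓ (-u)‖ := by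
          rw [← norm_mul, ← norm_mul]; exact norm_add_le _ _
      _ ≤ (K * (‖p.1‖ + ‖p.2‖)) * (‖ℓ‖ * (‖p.1‖ + ‖p.2‖)) + B * (‖ℓ‖ * (‖p.1‖ + ‖p.2‖)) := by
          gcongr
          · exact h3.trans (by gcongr)
          · exact h4.trans (by gcongr)
          · exact h5.trans (by gcongr)
      _ = _ := by ring
  · have hd := (hG.differentiable one_ne_zero (Real.cos θ • p.1 + Real.sin θ • p.2)).hasFDerivAt
    exact (hd.comp_hasDerivAt θ (hasDerivAt_rotation_fst p.1 p.2 θ)).mul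
      (ℓ.hasFDerivAt.comp_hasDerivAt θ (hasDerivAt_rotation_snd p.1 p.2 θ))

/-- The covariance between `F` and `exp (t F)` is at most `t c E[exp (t F)]`, where `c` bounds the
variances of the differentials of `F`. -/
lemma integral_mul_exp_le (hμ : ∫ x, x ∂μ = 0) {F : E → ℝ} (hF : ContDiff ℝ 1 F) {B K c : ℝ}
    (hB : ∀ x, |F x| ≤ B) (hK : ∀ x, ‖fderiv ℝ F x‖ ≤ K)
    (hc : ∀ x, ∫ y, (fderiv ℝ F x y) ^ 2 ∂μ ≤ c) {t : ℝ} (ht : 0 ≤ t) :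
    ∫ x, F x * Real.exp (t * F x) ∂μ ≤ (∫ x, F x ∂μ + t * c) * ∫ x, Real.exp (t * F x) ∂μ := by
  have hB0 : 0 ≤ B := (abs_nonneg _).trans (hB 0)
  have hK0 : 0 ≤ K := (norm_nonneg _).trans (hK 0)
  have hFc := hF.continuous
  have hF' : Continuous (fderiv ℝ F) := hF.continuous_fderiv one_ne_zero
  set g : E → ℝ := fun x => Real.exp (t * F x) with hg
  set M : ℝ := Real.exp (t * B) with hM
  have hg1 : ContDiff ℝ 1 g := (contDiff_const.mul hF).exp
  have hgc : Continuous g := hg1.continuous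
  have hg0 (x : E) : 0 ≤ g x := (Real.exp_pos _).le
  have hgM (x : E) : g x ≤ M :=
    Real.exp_le_exp.2 (mul_le_mul_of_nonneg_left ((le_abs_self _).trans (hB x)) ht)
  have hM0 : 0 ≤ M := (Real.exp_pos _).le
  have hgabs (x : E) : |g x| ≤ M := by rw [abs_of_nonneg (hg0 x)]; exact hgM x
  have hgint {ν : Measure (E × E)} [IsFiniteMeasure ν] {f : E × E → E} (hf : Continuous f) :
      Integrable (fun p => g (f p)) ν :=
    (integrable_const M).mono' (hgc.comp hf).aestronglyMeasurable
      (Filter.Eventually.of_forall fun p => hgabs _)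
  have hsq (x : E) : Integrable (fun y => (fderiv ℝ F x y) ^ 2) μ :=
    (IsGaussian.memLp_dual μ (fderiv ℝ F x) 2 (by simp)).integrable_sq
  have hcov (x z : E) : ∫ y, fderiv ℝ F x y * fderiv ℝ F z y ∂μ ≤ c := by
    have h1 : ∫ y, fderiv ℝ F x y * fderiv ℝ F z y ∂μ ≤
        ∫ y, (1 / 2 * (fderiv ℝ F x y) ^ 2 + 1 / 2 * (fderiv ℝ F z y) ^ 2) ∂μ := by
      refine integral_mono ?_ (((hsq x).const_mul _).add ((hsq z).const_mul _)) fun y => ?_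
      · exact (IsGaussian.memLp_dual μ (fderiv ℝ F x) 2 (by simp)).integrable_mul
          (IsGaussian.memLp_dual μ (fderiv ℝ F z) 2 (by simp))
      · simp only
        nlinarith [sq_nonneg (fderiv ℝ F x y - fderiv ℝ F z y)]
    rw [integral_add ((hsq x).const_mul _) ((hsq z).const_mul _), integral_const_mul,
      integral_const_mul] at h1
    linarith [hc x, hc z]
  set A : ℝ := ∫ x, g x ∂μ with hA
  set Φ : ℝ → ℝ := fun θ =>
    ∫ p : E × E, F (Real.cos θ • p.1 + Real.sin θ • p.2) * g p.1 ∂(μ.prod μ) with hΦ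
  have hder (θ : ℝ) : HasDerivAt Φ (∫ p : E × E, fderiv ℝ F (Real.cos θ • p.1 + Real.sin θ • p.2)
      (-Real.sin θ • p.1 + Real.cos θ • p.2) * g p.1 ∂(μ.prod μ)) θ := by
    have hcomp : Continuous fun p : E × E => fderiv ℝ F (Real.cos θ • p.1 + Real.sin θ • p.2)
      (-Real.sin θ • p.1 + Real.cos θ • p.2) := by fun_prop
    refine (hasDerivAt_integral_of_dominated_loc_of_deriv_le (μ := μ.prod μ)
      (F := fun θ (p : E × E) => F (Real.cos θ • p.1 + Real.sin θ • p.2) * g p.1)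
      (F' := fun θ (p : E × E) => fderiv ℝ F (Real.cos θ • p.1 + Real.sin θ • p.2)
        (-Real.sin θ • p.1 + Real.cos θ • p.2) * g p.1)
      (bound := fun p => K * M * (‖p.1‖ + ‖p.2‖)) Filter.univ_mem
      (Filter.Eventually.of_forall fun θ => Continuous.aestronglyMeasurable (by fun_prop))
      ?_ (Continuous.aestronglyMeasurable (by fun_prop))
      (Filter.Eventually.of_forall fun p θ _ => ?_) (integrable_norm_add_norm.const_mul _)
      (Filter.Eventually.of_forall fun p θ _ => ?_)).2
    · refine (integrable_const (B * M)).mono' (Continuous.aestronglyMeasurable (by fun_prop))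
        (Filter.Eventually.of_forall fun p => ?_)
      rw [norm_mul]
      exact mul_le_mul (hB _) (hgabs _) (norm_nonneg _) hB0
    · rw [norm_mul, mul_right_comm]
      refine mul_le_mul ?_ (hgabs _) (norm_nonneg _) (by positivity)
      refine ((fderiv ℝ F _).le_of_opNorm_le (hK _) _).trans ?_
      gcongr
      exact norm_rotation_snd_le _ _ _
    · exact ((hF.differentiable one_ne_zero _).hasFDerivAt.comp_hasDerivAt θ
        (hasDerivAt_rotation_fst p.1 p.2 θ)).mul_const _
  have hlower (θ : ℝ) (hs : 0 ≤ Real.sin θ) :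
      -(t * c * A * Real.sin θ) ≤ ∫ p : E × E, fderiv ℝ F (Real.cos θ • p.1 + Real.sin θ • p.2)
      (-Real.sin θ • p.1 + Real.cos θ • p.2) * g p.1 ∂(μ.prod μ) := by
    have hcomp : Continuous fun p : E × E => fderiv ℝ F p.1 p.2 := by fun_prop
    have hrot := integral_prod_rotation hμ θ (g := fun p =>
      fderiv ℝ F p.1 p.2 * g (Real.cos θ • p.1 + (-Real.sin θ) • p.2)) (by fun_prop)
    have hback (p : E × E) : Real.cos θ • (Real.cos θ • p.1 + Real.sin θ • p.2) +
        (-Real.sin θ) • (-Real.sin θ • p.1 + Real.cos θ • p.2) = p.1 := by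
      have : p.1 = (Real.cos θ ^ 2 + Real.sin θ ^ 2) • p.1 := by
        rw [Real.cos_sq_add_sin_sq, one_smul]
      conv_rhs => rw [this]
      module
    simp only [hback] at hrot
    have hI : Integrable (fun p : E × E =>
        fderiv ℝ F p.1 p.2 * g (Real.cos θ • p.1 + (-Real.sin θ) • p.2)) (μ.prod μ) := by
      refine (integrable_norm_add_norm.const_mul (K * M)).mono'
        (Continuous.aestronglyMeasurable (by fun_prop)) (Filter.Eventually.of_forall fun p => ?_)
      rw [norm_mul, mul_right_comm]
      refine mul_le_mul ?_ (hgabs _) (norm_nonneg _) (by positivity)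
      refine ((fderiv ℝ F _).le_of_opNorm_le (hK _) _).trans ?_
      gcongr
      linarith [norm_nonneg p.1]
    have hG : Integrable (fun p : E × E => g (Real.cos θ • p.1 + (-Real.sin θ) • p.2))
        (μ.prod μ) := hgint (by fun_prop)
    have hA' : ∫ p : E × E, g (Real.cos θ • p.1 + (-Real.sin θ) • p.2) ∂(μ.prod μ) = A := by
      have := integral_prod_rotation hμ (-θ) (g := fun p => g p.1) (by fun_prop)
      simp only [Real.cos_neg, Real.sin_neg] at this
      rw [this, integral_fun_fst (fun x => g x)]
      simp [hA]
    rw [hrot, integral_prod _ hI]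
    have hinner (u : E) : -(t * c * Real.sin θ) *
        ∫ v, g (Real.cos θ • u + (-Real.sin θ) • v) ∂μ ≤
        ∫ v, fderiv ℝ F u v * g (Real.cos θ • u + (-Real.sin θ) • v) ∂μ := by
      set T : E → E := fun v => Real.cos θ • u + (-Real.sin θ) • v with hT
      have hTd (v : E) : HasFDerivAt T ((-Real.sin θ) • ContinuousLinearMap.id ℝ E) v :=
        ((hasFDerivAt_id v).const_smul (-Real.sin θ)).const_add _
      have hT1 : ContDiff ℝ 1 T := by fun_prop
      have hTc : Continuous T := hT1.continuous
      have hfd (v : E) : fderiv ℝ (g ∘ T) v =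
          (-(t * Real.sin θ) * g (T v)) • fderiv ℝ F (T v) := by
        rw [((hg1.differentiable one_ne_zero (T v)).hasFDerivAt.comp v (hTd v)).fderiv]
        rw [hg, fderiv_exp_mul hF]
        ext y
        simp only [ContinuousLinearMap.comp_apply, _root_.smul_apply,
          ContinuousLinearMap.id_apply, smul_eq_mul, map_smul]
        ring
      have hst : 0 ≤ t * Real.sin θ := mul_nonneg ht hs
      have hst1 : t * Real.sin θ ≤ t := mul_le_of_le_one_right ht (Real.sin_le_one θ)
      have hfdn (v : E) : ‖fderiv ℝ (g ∘ T) v‖ ≤ t * M * K := by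
        rw [hfd, norm_smul, norm_mul, norm_neg, Real.norm_of_nonneg hst,
          Real.norm_of_nonneg (hg0 _)]
        have := hgM (T v)
        have := hg0 (T v)
        have := hK (T v)
        gcongr
      have hibp := integral_clm_mul_eq hμ (hg1.comp hT1) (fun v => hgabs (T v)) hfdn
        (fderiv ℝ F u)
      simp only [Function.comp_apply] at hibp
      rw [hibp, ← integral_const_mul]
      have hcomp2 : Continuous fun p : E × E => fderiv ℝ F (T p.1) p.2 := by fun_prop
      have hJ : Integrable (fun p : E × E => fderiv ℝ F u p.2 * fderiv ℝ (g ∘ T) p.1 p.2)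
          (μ.prod μ) := by
        refine (integrable_norm_add_norm_sq.const_mul (K * (t * M * K))).mono'
          (Continuous.aestronglyMeasurable ?_) (Filter.Eventually.of_forall fun p => ?_)
        · simp only [hfd, _root_.smul_apply, smul_eq_mul]
          fun_prop
        · rw [norm_mul]
          have h1 := (fderiv ℝ F u).le_of_opNorm_le (hK u) p.2
          have h2 := (fderiv ℝ (g ∘ T) p.1).le_of_opNorm_le (hfdn p.1) p.2
          calc _ ≤ (K * ‖p.2‖) * (t * M * K * ‖p.2‖) := by gcongr
            _ = K * (t * M * K) * (0 + ‖p.2‖) ^ 2 := by ring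
            _ ≤ _ := by gcongr; exact norm_nonneg _
      refine integral_mono ?_ hJ.integral_prod_left fun v => ?_
      · refine (integrable_const (|-(t * c * Real.sin θ)| * M)).mono'
          (Continuous.aestronglyMeasurable (by fun_prop)) (Filter.Eventually.of_forall fun v => ?_)
        rw [norm_mul]
        exact mul_le_mul_of_nonneg_left (hgabs _) (abs_nonneg _)
      · simp only [hfd, _root_.smul_apply, smul_eq_mul]
        have : ∀ y, fderiv ℝ F u y * (-(t * Real.sin θ) * g (T v) * fderiv ℝ F (T v) y) =
          -(t * Real.sin θ) * g (T v) * (fderiv ℝ F u y * fderiv ℝ F (T v) y) := fun y => by ring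
        simp_rw [this]
        rw [integral_const_mul]
        have := mul_le_mul_of_nonneg_left (hcov u (T v)) (mul_nonneg hst (hg0 (T v)))
        linarith
    calc -(t * c * A * Real.sin θ)
        = ∫ u, -(t * c * Real.sin θ) *
          ∫ v, g (Real.cos θ • u + (-Real.sin θ) • v) ∂μ ∂μ := by
          rw [integral_const_mul, ← integral_prod _ hG, hA']; ring
      _ ≤ _ := integral_mono (hG.integral_prod_left.const_mul _) hI.integral_prod_left hinner
  have hmono : MonotoneOn (fun θ => Φ θ - t * c * A * Real.cos θ)
      (Set.Icc 0 (Real.pi / 2)) := by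
    have hd (θ : ℝ) := (hder θ).sub ((Real.hasDerivAt_cos θ).const_mul (t * c * A))
    refine monotoneOn_of_hasDerivWithinAt_nonneg (convex_Icc _ _)
      (fun θ _ => (hd θ).continuousAt.continuousWithinAt)
      (fun θ _ => (hd θ).hasDerivWithinAt) fun θ hθ => ?_
    rw [interior_Icc] at hθ
    have := hlower θ (Real.sin_nonneg_of_nonneg_of_le_pi hθ.1.le
      (by linarith [hθ.2, Real.pi_pos]))
    linarith
  have hfin := hmono (Set.left_mem_Icc.2 (by positivity)) (Set.right_mem_Icc.2 (by positivity))
    (by positivity)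
  have h0 : Φ 0 = ∫ x, F x * g x ∂μ := by
    simp only [hΦ, Real.cos_zero, Real.sin_zero, one_smul, zero_smul, add_zero]
    rw [integral_fun_fst (fun x => F x * g x)]
    simp
  have h1 : Φ (Real.pi / 2) = (∫ x, F x ∂μ) * A := by
    simp only [hΦ, Real.cos_pi_div_two, Real.sin_pi_div_two, one_smul, zero_smul, zero_add]
    simp_rw [mul_comm (F _)]
    rw [integral_prod_mul g F, mul_comm]
  simp only [h0, h1, Real.cos_zero, Real.cos_pi_div_two] at hfin
  linarith

lemma integral_exp_mul_le (hμ : ∫ x, x ∂μ = 0) {F : E → ℝ} (hF : ContDiff ℝ 1 F) {B K c : ℝ}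
    (hB : ∀ x, |F x| ≤ B) (hK : ∀ x, ‖fderiv ℝ F x‖ ≤ K)
    (hc : ∀ x, ∫ y, (fderiv ℝ F x y) ^ 2 ∂μ ≤ c) {t : ℝ} (ht : 0 ≤ t) :
    ∫ x, Real.exp (t * F x) ∂μ ≤ Real.exp (t * ∫ x, F x ∂μ + c * t ^ 2 / 2) := by
  set m : ℝ := ∫ x, F x ∂μ with hm
  have hset : integrableExpSet F μ = Set.univ :=
    Set.eq_univ_of_forall fun t => integrable_exp_mul_of_abs_le hF.continuous hB t
  have hM (t : ℝ) : HasDerivAt (mgf F μ) (∫ x, F x * Real.exp (t * F x) ∂μ) t :=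
    hasDerivAt_mgf (by rw [hset, interior_univ]; trivial)
  have hE (t : ℝ) : HasDerivAt (fun t => Real.exp (-(t * m + c * t ^ 2 / 2)))
      (Real.exp (-(t * m + c * t ^ 2 / 2)) * -(m + t * c)) t := by
    refine HasDerivAt.exp (HasDerivAt.neg ?_)
    refine (((hasDerivAt_id' t).mul_const m).fun_add
      (((hasDerivAt_pow 2 t).const_mul c).div_const 2)).congr_deriv ?_
    simp
    ring
  have hd (t : ℝ) := (hM t).mul (hE t)
  have hanti : AntitoneOn (fun t => mgf F μ t * Real.exp (-(t * m + c * t ^ 2 / 2)))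
      (Set.Ici 0) := by
    refine antitoneOn_of_hasDerivWithinAt_nonpos (convex_Ici _)
      (fun t _ => (hd t).continuousAt.continuousWithinAt)
      (fun t _ => (hd t).hasDerivWithinAt) fun t ht => ?_
    rw [interior_Ici] at ht
    have h1 := integral_mul_exp_le hμ hF hB hK hc (le_of_lt ht)
    have h2 := mul_le_mul_of_nonneg_right h1 (Real.exp_pos (-(t * m + c * t ^ 2 / 2))).le
    simp only [mgf]
    linarith
  have h := hanti Set.self_mem_Ici ht ht
  simp only [mgf_zero, zero_mul, Real.exp_neg] at h
  simp only [mgf] at h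
  rw [mul_inv_le_iff₀ (Real.exp_pos _)] at h
  simpa using h

lemma measureReal_ge_le_exp_of_bounded (hμ : ∫ x, x ∂μ = 0) {F : E → ℝ} (hF : ContDiff ℝ 1 F)
    {B K c : ℝ} (hB : ∀ x, |F x| ≤ B) (hK : ∀ x, ‖fderiv ℝ F x‖ ≤ K)
    (hc : ∀ x, ∫ y, (fderiv ℝ F x y) ^ 2 ∂μ ≤ c) {s : ℝ} (hs : 0 ≤ s) :
    μ.real {x | ∫ x, F x ∂μ + s ≤ F x} ≤ Real.exp (-s ^ 2 / (2 * c)) := by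
  have hc0 : 0 ≤ c := (integral_nonneg fun y => sq_nonneg _).trans (hc 0)
  have ht : 0 ≤ s / c := div_nonneg hs hc0
  refine (measure_ge_le_exp_mul_mgf (μ := μ) (X := F) _ ht
    (integrable_exp_mul_of_abs_le hF.continuous hB _)).trans ?_
  refine (mul_le_mul_of_nonneg_left (integral_exp_mul_le hμ hF hB hK hc ht)
    (Real.exp_pos _).le).trans ?_
  rw [← Real.exp_add]
  refine Real.exp_le_exp.2 (le_of_eq ?_)
  rcases hc0.eq_or_lt with h | h
  · simp [← h]
  · field_simp
    ring

/-- **Gaussian concentration** with the sharp constant: if the differentials of `F` have variance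
at most `c` under the centered Gaussian measure `μ`, the upper tail of `F` is sub-Gaussian with
variance proxy `c`. -/
theorem measureReal_ge_le_exp (hμ : ∫ x, x ∂μ = 0) {F : E → ℝ} (hF : ContDiff ℝ 1 F)
    {K c : ℝ} (hK : ∀ x, ‖fderiv ℝ F x‖ ≤ K)
    (hc : ∀ x, ∫ y, (fderiv ℝ F x y) ^ 2 ∂μ ≤ c) {s : ℝ} (hs : 0 ≤ s) :
    μ.real {x | ∫ x, F x ∂μ + s ≤ F x} ≤ Real.exp (-s ^ 2 / (2 * c)) := by
  rcases hs.eq_or_lt with rfl | hs0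
  · simp
  set m : ℝ := ∫ x, F x ∂μ with hm
  have hFc := hF.continuous
  have hlin (x : E) : |F x| ≤ |F 0| + K * ‖x‖ := by
    have h1 := (convex_univ (𝕜 := ℝ) (E := E)).norm_image_sub_le_of_norm_fderiv_le (𝕜 := ℝ)
      (fun x _ => hF.differentiable one_ne_zero x) (fun x _ => hK x) (Set.mem_univ 0)
      (Set.mem_univ x)
    rw [sub_zero, Real.norm_eq_abs] at h1
    have := abs_sub_abs_le_abs_sub (F x) (F 0)
    linarith
  have hFint : Integrable F μ :=
    ((integrable_const |F 0|).add
      ((IsGaussian.integrable_id (μ := μ)).norm.const_mul K)).mono' hFc.aestronglyMeasurable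
      (Filter.Eventually.of_forall hlin)
  set T : ℕ → ℝ → ℝ := fun n u => (n + 1 : ℝ) * Real.arctan (u / (n + 1)) with hT
  have hTabs (n : ℕ) (u : ℝ) : |T n u| ≤ |u| := by
    have hn : (0 : ℝ) < n + 1 := by positivity
    have := abs_arctan_le_abs (u / (n + 1))
    rw [abs_div, abs_of_pos hn, le_div_iff₀ hn] at this
    rw [hT, abs_mul, abs_of_pos hn]
    linarith
  have hTlim (u : ℝ) : Filter.Tendsto (fun n => T n u) Filter.atTop (nhds u) :=
    tendsto_mul_arctan_div u
  have hTd (n : ℕ) (x : E) : fderiv ℝ (fun x => T n (F x)) x =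
      (1 / (1 + (F x / (n + 1)) ^ 2)) • fderiv ℝ F x := by
    have hn : (n + 1 : ℝ) ≠ 0 := by positivity
    have h1 : HasDerivAt (T n) (1 / (1 + (F x / (n + 1)) ^ 2)) (F x) := by
      refine (((hasDerivAt_id' (F x)).div_const (n + 1 : ℝ)).arctan.const_mul
        (n + 1 : ℝ)).congr_deriv ?_
      field_simp
    exact (h1.comp_hasFDerivAt x (hF.differentiable one_ne_zero x).hasFDerivAt).fderiv
  have hcoef (n : ℕ) (x : E) : 0 ≤ 1 / (1 + (F x / (n + 1)) ^ 2) ∧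
      1 / (1 + (F x / (n + 1)) ^ 2) ≤ 1 := by
    refine ⟨by positivity, ?_⟩
    rw [div_le_one (by positivity)]
    linarith [sq_nonneg (F x / (n + 1))]
  have hTC (n : ℕ) : ContDiff ℝ 1 (fun x => T n (F x)) :=
    contDiff_const.mul (Real.contDiff_arctan.comp (hF.div_const _))
  have hbound (n : ℕ) {r : ℝ} (hr : 0 ≤ r) : μ.real {x | ∫ x, T n (F x) ∂μ + r ≤ T n (F x)} ≤
      Real.exp (-r ^ 2 / (2 * c)) := by
    refine measureReal_ge_le_exp_of_bounded hμ (hTC n) (B := (n + 1) * (Real.pi / 2)) (K := K)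
      (fun x => ?_) (fun x => ?_) (fun x => ?_) hr
    · rw [hT, abs_mul, abs_of_pos (by positivity)]
      exact mul_le_mul_of_nonneg_left (abs_le.2
        ⟨(Real.neg_pi_div_two_lt_arctan _).le, (Real.arctan_lt_pi_div_two _).le⟩) (by positivity)
    · rw [hTd, norm_smul, Real.norm_of_nonneg (hcoef n x).1]
      exact (mul_le_of_le_one_left (norm_nonneg _) (hcoef n x).2).trans (hK x)
    · simp only [hTd, _root_.smul_apply, smul_eq_mul, mul_pow]
      rw [integral_const_mul]
      exact (mul_le_of_le_one_left (integral_nonneg fun y => sq_nonneg _)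
        (pow_le_one₀ (hcoef n x).1 (hcoef n x).2)).trans (hc x)
  have hmlim : Filter.Tendsto (fun n => ∫ x, T n (F x) ∂μ) Filter.atTop (nhds m) :=
    tendsto_integral_of_dominated_convergence (fun x => |F x|)
      (fun n => (hTC n).continuous.aestronglyMeasurable) hFint.abs
      (fun n => Filter.Eventually.of_forall fun x => hTabs n _)
      (Filter.Eventually.of_forall fun x => hTlim _)
  have hslim : Filter.Tendsto (fun n => T n (m + s) - ∫ x, T n (F x) ∂μ) Filter.atTop
      (nhds s) := by
    simpa using (hTlim (m + s)).sub hmlim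
  have hexp : Filter.Tendsto
      (fun n => Real.exp (-(T n (m + s) - ∫ x, T n (F x) ∂μ) ^ 2 / (2 * c))) Filter.atTop
      (nhds (Real.exp (-s ^ 2 / (2 * c)))) :=
    (Real.continuous_exp.tendsto _).comp ((hslim.pow 2).neg.div_const _)
  refine ge_of_tendsto hexp ?_
  filter_upwards [hslim.eventually (lt_mem_nhds hs0)] with n hn
  refine (measureReal_mono fun x hx => ?_).trans (hbound n hn.le)
  simp only [Set.mem_ofPred_eq] at hx ⊢
  rw [add_sub_cancel]
  exact mul_le_mul_of_nonneg_left (Real.arctan_mono (by gcongr)) (by positivity)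

end GaussianConcentration

section ComplexGaussian

/-- The real-linear identification of `ℝ × ℝ` with `ℂ`. -/
def prodToComplex : ℝ × ℝ →L[ℝ] ℂ :=
  Complex.equivRealProdCLM.symm

lemma cgaussian_eq_map (σ2 : ℝ) : cgaussian σ2 = Measure.map prodToComplex
    ((gaussianReal 0 (σ2 / 2).toNNReal).prod (gaussianReal 0 (σ2 / 2).toNNReal)) := by
  rw [cgaussian]
  congr 1
  funext p
  apply Complex.ext <;> simp [prodToComplex]

instance isGaussian_cgaussian (σ2 : ℝ) : IsGaussian (cgaussian σ2) := by
  rw [cgaussian_eq_map]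
  infer_instance

instance isGaussian_cgaussianVec (m : ℕ) (σ2 : ℝ) : IsGaussian (cgaussianVec m σ2) := by
  have h1 (i : Fin m) : HasGaussianLaw (fun a : Fin m → ℂ => a i) (cgaussianVec m σ2) := by
    constructor
    rw [cgaussianVec, (measurePreserving_eval (fun _ : Fin m => cgaussian σ2) i).map_eq]
    infer_instance
  have h2 : iIndepFun (fun (i : Fin m) (a : Fin m → ℂ) => a i) (cgaussianVec m σ2) :=
    iIndepFun_pi (μ := fun _ : Fin m => cgaussian σ2) (X := fun _ => id) fun _ => aemeasurable_id
  simpa using (iIndepFun.hasGaussianLaw h1 h2).isGaussian_map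

lemma integral_cgaussian {F : Type*} [NormedAddCommGroup F] [NormedSpace ℝ F] (σ2 : ℝ)
    {f : ℂ → F} (hf : Continuous f) [SecondCountableTopology F] :
    ∫ z, f z ∂cgaussian σ2 = ∫ p : ℝ × ℝ, f (prodToComplex p)
      ∂(gaussianReal 0 (σ2 / 2).toNNReal).prod (gaussianReal 0 (σ2 / 2).toNNReal) := by
  borelize F
  rw [cgaussian_eq_map, integral_map (by fun_prop) hf.aestronglyMeasurable]

lemma charFun_cgaussian {σ2 : ℝ} (hσ : 0 ≤ σ2) (t : ℂ) :
    charFun (cgaussian σ2) t = Complex.exp (-(σ2 * ‖t‖ ^ 2 / 4 : ℝ)) := by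
  rw [charFun_apply, integral_cgaussian _ (by fun_prop)]
  have (p : ℝ × ℝ) : Complex.exp (inner ℝ (prodToComplex p) t * I) =
      Complex.exp (t.re * p.1 * I) * Complex.exp (t.im * p.2 * I) := by
    rw [← Complex.exp_add]
    simp [prodToComplex, Complex.inner]
    ring_nf
  simp_rw [this]
  rw [integral_prod_mul (fun u : ℝ => Complex.exp (t.re * u * I))
    (fun u : ℝ => Complex.exp (t.im * u * I)), ← charFun_apply_real, ← charFun_apply_real,
    charFun_gaussianReal, charFun_gaussianReal, ← Complex.exp_add, Complex.sq_norm,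
    Complex.normSq_apply, Real.coe_toNNReal _ (by positivity)]
  congr 1
  push_cast
  ring

lemma map_sum_mul_cgaussianVec {m : ℕ} (c : Fin m → ℂ) :
    (cgaussianVec m 1).map (fun a => ∑ k, c k * a k) = cgaussian (∑ k, ‖c k‖ ^ 2) := by
  have : IsFiniteMeasure ((cgaussianVec m 1).map (fun a => ∑ k, c k * a k)) := inferInstance
  refine Measure.ext_of_charFun (funext fun t => ?_)
  rw [charFun_cgaussian (by positivity), charFun_apply,
    integral_map (Continuous.aemeasurable (by fun_prop))
      (Continuous.aestronglyMeasurable (by fun_prop))]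
  have (a : Fin m → ℂ) : Complex.exp (inner ℝ (∑ k, c k * a k) t * I) =
      ∏ k, Complex.exp (inner ℝ (a k) (starRingEnd ℂ (c k) * t) * I) := by
    rw [← Complex.exp_sum, sum_inner, Complex.ofReal_sum, Finset.sum_mul]
    congr 1
    refine Finset.sum_congr rfl fun k _ => ?_
    simp only [Complex.inner, map_mul]
    ring_nf
  simp_rw [this]
  rw [cgaussianVec, integral_fintype_prod_eq_prod (𝕜 := ℂ)
    (fun k z => Complex.exp (inner ℝ z (starRingEnd ℂ (c k) * t) * I))]
  simp_rw [← charFun_apply, charFun_cgaussian zero_le_one, ← Complex.exp_sum]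
  congr 1
  push_cast
  simp only [norm_mul, RCLike.norm_conj, Finset.sum_neg_distrib, Finset.sum_mul, Finset.sum_div]
  congr 1
  refine Finset.sum_congr rfl fun k _ => ?_
  push_cast
  ring

lemma integral_id_cgaussian (σ2 : ℝ) : ∫ z, z ∂cgaussian σ2 = 0 := by
  rw [integral_cgaussian (f := fun z => z) _ continuous_id, ContinuousLinearMap.integral_comp_comm
    prodToComplex (φ := fun p => p) IsGaussian.integrable_id]
  have h (μ : Measure (ℝ × ℝ)) [IsGaussian μ] : ∫ p, p ∂μ = (∫ p, p.1 ∂μ, ∫ p, p.2 ∂μ) :=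
    Prod.ext (((ContinuousLinearMap.fst ℝ ℝ ℝ).integral_comp_comm IsGaussian.integrable_id).symm)
      (((ContinuousLinearMap.snd ℝ ℝ ℝ).integral_comp_comm IsGaussian.integrable_id).symm)
  rw [h, integral_fun_fst (fun x : ℝ => x), integral_fun_snd (fun x : ℝ => x)]
  simp [Prod.mk_zero_zero]

lemma integral_sq_gaussianReal (v : ℝ≥0) : ∫ x, x ^ 2 ∂gaussianReal 0 v = v := by
  have h := variance_id_gaussianReal (μ := 0) (v := v)
  rw [variance_eq_integral (by fun_prop)] at h
  simpa using h

lemma integral_re_sq_cgaussian {σ2 : ℝ} (hσ : 0 ≤ σ2) :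
    ∫ z, z.re ^ 2 ∂cgaussian σ2 = σ2 / 2 := by
  rw [integral_cgaussian _ (by fun_prop)]
  simp only [prodToComplex]
  have h := integral_fun_fst (μ := gaussianReal 0 (σ2 / 2).toNNReal)
    (ν := gaussianReal 0 (σ2 / 2).toNNReal) (fun x : ℝ => x ^ 2)
  rw [integral_sq_gaussianReal, Real.coe_toNNReal _ (by positivity)] at h
  simpa using h

lemma integral_im_sq_cgaussian {σ2 : ℝ} (hσ : 0 ≤ σ2) :
    ∫ z, z.im ^ 2 ∂cgaussian σ2 = σ2 / 2 := by
  rw [integral_cgaussian _ (by fun_prop)]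
  simp only [prodToComplex]
  have h := integral_fun_snd (μ := gaussianReal 0 (σ2 / 2).toNNReal)
    (ν := gaussianReal 0 (σ2 / 2).toNNReal) (fun x : ℝ => x ^ 2)
  rw [integral_sq_gaussianReal, Real.coe_toNNReal _ (by positivity)] at h
  simpa using h

lemma integrable_norm_sq_cgaussian (σ2 : ℝ) :
    Integrable (fun z : ℂ => ‖z‖ ^ 2) (cgaussian σ2) :=
  (IsGaussian.memLp_two_id (μ := cgaussian σ2)).integrable_norm_pow two_ne_zero

lemma integral_norm_sq_cgaussian {σ2 : ℝ} (hσ : 0 ≤ σ2) :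
    ∫ z, ‖z‖ ^ 2 ∂cgaussian σ2 = σ2 := by
  have h (z : ℂ) : ‖z‖ ^ 2 = z.re ^ 2 + z.im ^ 2 := by
    rw [Complex.sq_norm, Complex.normSq_apply]; ring
  have hre : Integrable (fun z : ℂ => z.re ^ 2) (cgaussian σ2) :=
    (integrable_norm_sq_cgaussian σ2).mono' (Continuous.aestronglyMeasurable (by fun_prop))
      (Filter.Eventually.of_forall fun z => by
        rw [Real.norm_of_nonneg (sq_nonneg _), h]; linarith [sq_nonneg z.im])
  have him : Integrable (fun z : ℂ => z.im ^ 2) (cgaussian σ2) :=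
    (integrable_norm_sq_cgaussian σ2).mono' (Continuous.aestronglyMeasurable (by fun_prop))
      (Filter.Eventually.of_forall fun z => by
        rw [Real.norm_of_nonneg (sq_nonneg _), h]; linarith [sq_nonneg z.re])
  simp_rw [h]
  rw [integral_add hre him, integral_re_sq_cgaussian hσ, integral_im_sq_cgaussian hσ]
  ring

lemma integral_exp_neg_mul_sq_gaussianReal {p : ℝ} (hp : 0 ≤ p) :
    ∫ x, Real.exp (-p * x ^ 2) ∂gaussianReal 0 (1 / 2) = (Real.sqrt (1 + p))⁻¹ := by
  rw [integral_gaussianReal_eq_integral_smul (by norm_num)]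
  have (x : ℝ) : gaussianPDFReal 0 (1 / 2) x • Real.exp (-p * x ^ 2) =
      (Real.sqrt Real.pi)⁻¹ * Real.exp (-(1 + p) * x ^ 2) := by
    simp only [gaussianPDFReal, smul_eq_mul, mul_assoc, ← Real.exp_add]
    congr 2
    · simp
      field_simp
    · push_cast
      ring
  simp_rw [this]
  rw [integral_const_mul, integral_gaussian, Real.sqrt_div Real.pi_pos.le]
  have := Real.sqrt_pos.2 Real.pi_pos
  field_simp

lemma integral_exp_neg_mul_norm_sq_cgaussian {p : ℝ} (hp : 0 ≤ p) :
    ∫ z, Real.exp (-p * ‖z‖ ^ 2) ∂cgaussian 1 = (1 + p)⁻¹ := by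
  rw [integral_cgaussian _ (by fun_prop)]
  have (q : ℝ × ℝ) : Real.exp (-p * ‖prodToComplex q‖ ^ 2) =
      Real.exp (-p * q.1 ^ 2) * Real.exp (-p * q.2 ^ 2) := by
    rw [← Real.exp_add, Complex.sq_norm, Complex.normSq_apply]
    simp [prodToComplex]
    ring
  simp_rw [this]
  rw [integral_prod_mul (fun u : ℝ => Real.exp (-p * u ^ 2))
    (fun u : ℝ => Real.exp (-p * u ^ 2))]
  have h2 : (1 / 2 : ℝ).toNNReal = 1 / 2 := by
    rw [Real.toNNReal_div (by norm_num)]; simp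
  rw [h2, integral_exp_neg_mul_sq_gaussianReal hp, ← mul_inv, Real.mul_self_sqrt (by positivity)]

lemma integral_id_cgaussianVec (m : ℕ) (σ2 : ℝ) : ∫ a, a ∂cgaussianVec m σ2 = 0 := by
  ext i
  have h := (ContinuousLinearMap.proj (R := ℝ) (φ := fun _ : Fin m => ℂ) i).integral_comp_comm
    (μ := cgaussianVec m σ2) (φ := fun a => a) IsGaussian.integrable_id
  simp only [ContinuousLinearMap.proj_apply] at h
  have hmap : (cgaussianVec m σ2).map (fun a => a i) = cgaussian σ2 :=
    (measurePreserving_eval (fun _ : Fin m => cgaussian σ2) i).map_eq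
  rw [← h, ← integral_map (f := fun z : ℂ => z)
    (φ := fun a : Fin m → ℂ => a i) (measurable_pi_apply i).aemeasurable
    continuous_id.aestronglyMeasurable, hmap, integral_id_cgaussian]
  rfl

lemma integral_re_sum_mul_sq {m : ℕ} (c : Fin m → ℂ) :
    ∫ a, (∑ k, c k * a k).re ^ 2 ∂cgaussianVec m 1 = (∑ k, ‖c k‖ ^ 2) / 2 := by
  rw [← integral_re_sq_cgaussian (by positivity), ← map_sum_mul_cgaussianVec,
    integral_map (Continuous.aemeasurable (by fun_prop))
      (Continuous.aestronglyMeasurable (by fun_prop))]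

end ComplexGaussian

section OperatorNorm

open scoped Matrix.Norms.L2Operator

lemma cnorm_eq_norm_toLp {k : ℕ} (v : Fin k → ℂ) : cnorm v = ‖WithLp.toLp 2 v‖ := by
  rw [EuclideanSpace.norm_eq, cnorm]

lemma cnorm_mulVec_le_l2_opNorm {k l : ℕ} (M : Matrix (Fin k) (Fin l) ℂ) (v : Fin l → ℂ) :
    cnorm (M.mulVec v) ≤ ‖M‖ * cnorm v := by
  rw [cnorm_eq_norm_toLp, cnorm_eq_norm_toLp]
  exact Matrix.l2_opNorm_mulVec M (WithLp.toLp 2 v)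

lemma cnorm_mulVec_le {k l : ℕ} (M : Matrix (Fin k) (Fin l) ℂ) (v : Fin l → ℂ) :
    cnorm (M.mulVec v) ≤ opNorm M * cnorm v := by
  have hbdd : BddAbove {r : ℝ | ∃ v : Fin l → ℂ, cnorm v ≤ 1 ∧ r = cnorm (M.mulVec v)} := by
    refine ⟨‖M‖, ?_⟩
    rintro r ⟨v, hv, rfl⟩
    exact (cnorm_mulVec_le_l2_opNorm M v).trans (mul_le_of_le_one_right (norm_nonneg _) hv)
  rcases eq_or_ne (cnorm v) 0 with h0 | h0
  · have := cnorm_mulVec_le_l2_opNorm M v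
    rw [h0, mul_zero] at this ⊢
    exact this
  have hpos : 0 < cnorm v := lt_of_le_of_ne (Real.sqrt_nonneg _) h0.symm
  have hsmul {j : ℕ} (w : Fin j → ℂ) :
      cnorm (((cnorm v)⁻¹ : ℂ) • w) = (cnorm v)⁻¹ * cnorm w := by
    rw [cnorm_eq_norm_toLp (_ • w), WithLp.toLp_smul, norm_smul, ← cnorm_eq_norm_toLp]
    simp [abs_of_pos hpos]
  have h := le_csSup hbdd ⟨((cnorm v)⁻¹ : ℂ) • v, by rw [hsmul, inv_mul_cancel₀ h0], rfl⟩
  rw [Matrix.mulVec_smul, hsmul, inv_mul_le_iff₀ hpos, mul_comm] at h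
  exact h

lemma opNorm_nonneg {k l : ℕ} (M : Matrix (Fin k) (Fin l) ℂ) : 0 ≤ opNorm M := by
  refine Real.sSup_nonneg ?_
  rintro r ⟨v, -, rfl⟩
  exact Real.sqrt_nonneg _

lemma l2_opNorm_le_opNorm {k l : ℕ} (M : Matrix (Fin k) (Fin l) ℂ) : ‖M‖ ≤ opNorm M := by
  rw [Matrix.l2_opNorm_def]
  refine ContinuousLinearMap.opNorm_le_bound _ ?_ fun v => ?_
  · exact opNorm_nonneg M
  · have h := cnorm_mulVec_le M v.ofLp
    rw [cnorm_eq_norm_toLp, cnorm_eq_norm_toLp] at h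
    exact h

lemma cnorm_conjTranspose_mulVec_le {k l : ℕ} (M : Matrix (Fin k) (Fin l) ℂ) (w : Fin k → ℂ) :
    cnorm (Mᴴ.mulVec w) ≤ opNorm M * cnorm w := by
  refine (cnorm_mulVec_le_l2_opNorm _ _).trans ?_
  rw [Matrix.l2_opNorm_conjTranspose]
  exact mul_le_mul_of_nonneg_right (l2_opNorm_le_opNorm M) (Real.sqrt_nonneg _)

end OperatorNorm

section Circulant

variable {n m : ℕ}

lemma sum_pad {F : Type*} [AddCommMonoid F] (h : n ≤ m) (x : Fin n → ℂ) (f : ℂ → Fin m → F)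
    (hf : ∀ j, f 0 j = 0) : ∑ j, f (pad m x j) j = ∑ j, f (x j) (Fin.castLE h j) := by
  symm
  refine Fintype.sum_of_injective (Fin.castLE h) (Fin.castLE_injective h) _ _ (fun j hj => ?_)
    fun j => ?_
  · have : ¬ (j : ℕ) < n := fun hjn => hj ⟨⟨j, hjn⟩, rfl⟩
    simp [pad, this, hf]
  · simp [pad]

lemma Amat_mulVec_eq_Cx_mulVec (h : n ≤ m) (x : Fin n → ℂ) (a : Fin m → ℂ) :
    (Amat h a).mulVec x = (Cx m x).mulVec a := by
  funext i
  have : NeZero m := ⟨i.pos.ne'⟩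
  simp only [Matrix.mulVec, dotProduct, Amat, Cx, Matrix.of_apply, Matrix.circulant_apply]
  rw [← (Equiv.subLeft i).sum_comp]
  simp only [Equiv.subLeft_apply, sub_sub_cancel]
  rw [sum_pad h x (fun z j => z * a (i - j)) (by simp)]
  exact Finset.sum_congr rfl fun j _ => mul_comm _ _

lemma sum_norm_sq_Cx_apply (h : n ≤ m) (x : Fin n → ℂ) (i : Fin m) :
    ∑ k, ‖Cx m x i k‖ ^ 2 = cnorm x ^ 2 := by
  have : NeZero m := ⟨i.pos.ne'⟩
  simp only [Cx, Matrix.circulant_apply]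
  rw [← (Equiv.subLeft i).sum_comp]
  simp only [Equiv.subLeft_apply, sub_sub_cancel]
  rw [sum_pad h x (fun z _ => ‖z‖ ^ 2) (by simp), cnorm, Real.sq_sqrt (by positivity)]

end Circulant

section Hat

lemma one_sub_le_exp_neg_mul_sq {v : ℝ} (hv : 0 ≤ v) :
    1 - v ≤ Real.exp (-(1.54 ^ 2 * v ^ 2)) := by
  rcases le_or_gt 1 v with h1 | h1
  · exact (sub_nonpos.2 h1).trans (Real.exp_pos _).le
  have hlog : ∑ i ∈ Finset.range 8, v ^ (i + 1) / ((i : ℝ) + 1) ≤ -Real.log (1 - v) :=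
    sum_le_hasSum _ (fun i _ => by positivity)
      (Real.hasSum_pow_div_log_of_abs_lt_one (by rwa [abs_of_nonneg hv]))
  have hpoly : 0 ≤ 1 - (1.54 ^ 2 - 1 / 2) * v + v ^ 2 / 3 + v ^ 3 / 4 + v ^ 4 / 5 + v ^ 5 / 6
      + v ^ 6 / 7 := by
    have h2 := sq_nonneg (v - 0.775)
    have h3 := mul_nonneg h2 (by positivity : 0 ≤ v + 2 * 0.775)
    have h4 := mul_nonneg h2 (by positivity : 0 ≤ v ^ 2 + 2 * 0.775 * v + 3 * 0.775 ^ 2)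
    have h5 := mul_nonneg h2 (by positivity :
      0 ≤ v ^ 3 + 2 * 0.775 * v ^ 2 + 3 * 0.775 ^ 2 * v + 4 * 0.775 ^ 3)
    have h6 := mul_nonneg h2 (by positivity :
      0 ≤ v ^ 4 + 2 * 0.775 * v ^ 3 + 3 * 0.775 ^ 2 * v ^ 2 + 4 * 0.775 ^ 3 * v
        + 5 * 0.775 ^ 4)
    linarith
  have h := mul_nonneg hv hpoly
  simp only [Finset.sum_range_succ, Finset.sum_range_zero] at hlog
  norm_num at hlog
  rw [← Real.exp_log (sub_pos.2 h1)]
  refine Real.exp_le_exp.2 ?_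
  linarith [pow_nonneg hv 8]

/-- A smooth approximation from above of the positive part. -/
def smoothPos (η t : ℝ) : ℝ := (t + Real.sqrt (t ^ 2 + η ^ 2)) / 2

/-- A smooth approximation from below of the modulus. -/
def smoothAbs (η : ℝ) (z : ℂ) : ℝ := Real.sqrt (‖z‖ ^ 2 + η ^ 2) - η

/-- A smooth approximation from above of the hat function `(τ - |z|)₊`. -/
def smoothHat (τ η : ℝ) (z : ℂ) : ℝ := smoothPos η (τ - smoothAbs η z)

variable {τ η : ℝ}

lemma self_le_smoothPos (t : ℝ) : t ≤ smoothPos η t := by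
  have := Real.le_sqrt_of_sq_le (x := t) (y := t ^ 2 + η ^ 2) (by nlinarith [sq_nonneg η])
  rw [smoothPos]
  linarith

lemma smoothPos_nonneg (t : ℝ) : 0 ≤ smoothPos η t := by
  have := Real.le_sqrt_of_sq_le (x := -t) (y := t ^ 2 + η ^ 2) (by nlinarith [sq_nonneg η])
  rw [smoothPos]
  linarith

lemma smoothPos_le (hη : 0 ≤ η) (t : ℝ) : smoothPos η t ≤ max t 0 + η / 2 := by
  have : Real.sqrt (t ^ 2 + η ^ 2) ≤ |t| + η := by
    refine Real.sqrt_le_iff.2 ⟨by positivity, ?_⟩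
    nlinarith [sq_abs t, mul_nonneg (abs_nonneg t) hη]
  rw [smoothPos]
  rcases le_total t 0 with h | h
  · rw [max_eq_right h]
    rw [abs_of_nonpos h] at this
    linarith
  · rw [max_eq_left h]
    rw [abs_of_nonneg h] at this
    linarith

lemma smoothAbs_le (hη : 0 ≤ η) (z : ℂ) : smoothAbs η z ≤ ‖z‖ := by
  have : Real.sqrt (‖z‖ ^ 2 + η ^ 2) ≤ ‖z‖ + η := by
    refine Real.sqrt_le_iff.2 ⟨by positivity, ?_⟩
    nlinarith [mul_nonneg (norm_nonneg z) hη]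
  rw [smoothAbs]
  linarith

lemma norm_sub_le_smoothAbs (z : ℂ) : ‖z‖ - η ≤ smoothAbs η z := by
  have := Real.le_sqrt_of_sq_le (x := ‖z‖) (y := ‖z‖ ^ 2 + η ^ 2) (by nlinarith [sq_nonneg η])
  rw [smoothAbs]
  linarith

lemma sub_norm_le_smoothHat (hη : 0 ≤ η) (z : ℂ) : τ - ‖z‖ ≤ smoothHat τ η z :=
  (sub_le_sub_left (smoothAbs_le hη z) τ).trans (self_le_smoothPos _)

lemma smoothHat_nonneg (z : ℂ) : 0 ≤ smoothHat τ η z := smoothPos_nonneg _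

lemma smoothHat_le (hη : 0 ≤ η) (z : ℂ) :
    smoothHat τ η z ≤ max (τ - ‖z‖) 0 + 3 / 2 * η := by
  refine (smoothPos_le hη _).trans ?_
  have h := norm_sub_le_smoothAbs (η := η) z
  have : max (τ - smoothAbs η z) 0 ≤ max (τ - ‖z‖) 0 + η := by
    refine max_le ?_ (by positivity)
    linarith [le_max_left (τ - ‖z‖) 0]
  linarith

lemma contDiff_smoothPos (hη : 0 < η) : ContDiff ℝ 1 (smoothPos η) :=
  (contDiff_id.add (((contDiff_id.pow 2).add contDiff_const).sqrt
    fun x => (by positivity : id x ^ 2 + η ^ 2 ≠ 0))).div_const 2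

lemma contDiff_smoothAbs (hη : 0 < η) : ContDiff ℝ 1 (smoothAbs η) :=
  ((((contDiff_norm_sq ℝ (E := ℂ)).add contDiff_const).sqrt
    fun x => (by positivity : ‖x‖ ^ 2 + η ^ 2 ≠ 0))).sub contDiff_const

lemma contDiff_smoothHat (hη : 0 < η) : ContDiff ℝ 1 (smoothHat τ η) :=
  (contDiff_smoothPos hη).comp (contDiff_const.sub (contDiff_smoothAbs hη))

lemma exists_hasFDerivAt_smoothHat (hη : 0 < η) (z : ℂ) : ∃ g : ℝ, |g| * ‖z‖ ≤ 1 ∧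
    HasFDerivAt (smoothHat τ η) (g • innerSL ℝ z) z := by
  set r : ℝ := Real.sqrt (‖z‖ ^ 2 + η ^ 2) with hr
  have hr0 : 0 < r := Real.sqrt_pos.2 (by positivity)
  set t : ℝ := τ - smoothAbs η z with ht
  set q : ℝ := Real.sqrt (t ^ 2 + η ^ 2) with hq
  have hq0 : 0 < q := Real.sqrt_pos.2 (by positivity)
  have hzr : ‖z‖ ≤ r := Real.le_sqrt_of_sq_le (by nlinarith [sq_nonneg η])
  have htq : |t| ≤ q := Real.le_sqrt_of_sq_le (by nlinarith [sq_nonneg η, sq_abs t])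
  have h1 : HasDerivAt (smoothPos η) ((1 + t / q) / 2) t := by
    refine (((hasDerivAt_id' t).fun_add
      (((hasDerivAt_pow 2 t).add_const (η ^ 2)).sqrt (by positivity))).div_const 2).congr_deriv ?_
    rw [← hq]
    simp
    field_simp
  have h2 : HasFDerivAt (fun z => τ - smoothAbs η z) (-((1 / (2 * r)) • 2 • innerSL ℝ z)) z :=
    ((((hasStrictFDerivAt_norm_sq z).hasFDerivAt.add_const (η ^ 2)).sqrt
      (by positivity)).sub_const η).const_sub τ
  refine ⟨-((1 + t / q) / 2 / r), ?_, ?_⟩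
  · have h3 := abs_le.1 htq
    have h4 : 0 ≤ 1 + t / q := by
      rw [← neg_le_iff_add_nonneg', le_div_iff₀ hq0]; linarith
    have h5 : t / q ≤ 1 := (div_le_one hq0).2 h3.2
    rw [abs_neg, abs_of_nonneg (by positivity), div_mul_eq_mul_div, div_le_one hr0]
    refine (mul_le_of_le_one_left (norm_nonneg z) ?_).trans hzr
    linarith
  · refine (h1.comp_hasFDerivAt z h2).congr_fderiv ?_
    ext y
    simp
    field_simp

end Hat

section Functional

variable {m : ℕ} {τ η κ δ : ℝ}

/-- A smooth functional that is large at every vector with a large subset of small entries. -/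
def subsetFunctional (τ η κ δ : ℝ) (z : Fin m → ℂ) : ℝ :=
  ∑ k, smoothHat τ η (z k) + κ * Real.sqrt (∑ k, ‖z k‖ ^ 2 + δ)

lemma contDiff_subsetFunctional (hη : 0 < η) (hδ : 0 < δ) :
    ContDiff ℝ 1 (subsetFunctional (m := m) τ η κ δ) := by
  refine (ContDiff.sum fun k _ => (contDiff_smoothHat hη).comp (contDiff_apply ℝ ℂ k)).add
    (contDiff_const.mul (ContDiff.sqrt ((ContDiff.sum fun k _ =>
      (contDiff_norm_sq ℝ).comp (contDiff_apply ℝ ℂ k)).add contDiff_const) fun z => ?_))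
  positivity

lemma exists_hasFDerivAt_subsetFunctional (hη : 0 < η) (hδ : 0 < δ) (hκ : 0 ≤ κ)
    (z : Fin m → ℂ) : ∃ (w : Fin m → ℂ) (f' : (Fin m → ℂ) →L[ℝ] ℝ),
      cnorm w ≤ Real.sqrt m + κ ∧ HasFDerivAt (subsetFunctional τ η κ δ) f' z ∧
      ∀ y, f' y = (∑ k, starRingEnd ℂ (w k) * y k).re := by
  choose g hg hgd using fun k => exists_hasFDerivAt_smoothHat (τ := τ) hη (z k)
  set N : ℝ := Real.sqrt (∑ k, ‖z k‖ ^ 2 + δ) with hN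
  have hpos : 0 < ∑ k, ‖z k‖ ^ 2 + δ := by positivity
  have hN0 : 0 < N := Real.sqrt_pos.2 hpos
  have hcoord (k : Fin m) : HasFDerivAt (fun z : Fin m → ℂ => z k)
      (ContinuousLinearMap.proj (R := ℝ) (φ := fun _ : Fin m => ℂ) k) z :=
    hasFDerivAt_apply k z
  have h1 := HasFDerivAt.fun_sum (u := Finset.univ) fun k _ => (hgd k).comp z (hcoord k)
  have h2 := (((HasFDerivAt.fun_sum (u := Finset.univ) fun k _ =>
    (hasStrictFDerivAt_norm_sq (z k)).hasFDerivAt.comp (g := fun x : ℂ => ‖x‖ ^ 2) z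
      (hcoord k)).add_const δ).sqrt
      hpos.ne').const_mul κ
  refine ⟨fun k => ((g k : ℝ) : ℂ) * z k + ((κ / N : ℝ) : ℂ) * z k, _, ?_, h1.add h2, ?_⟩
  · have hw1 : cnorm (fun k => ((g k : ℝ) : ℂ) * z k) ≤ Real.sqrt m := by
      refine Real.sqrt_le_sqrt ?_
      calc _ ≤ ∑ _k : Fin m, (1 : ℝ) := Finset.sum_le_sum fun k _ => by
            rw [norm_mul, Complex.norm_real, Real.norm_eq_abs]
            exact pow_le_one₀ (by positivity) (hg k)
        _ = m := by simp
    have hw2 : cnorm (fun k => ((κ / N : ℝ) : ℂ) * z k) ≤ κ := by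
      refine Real.sqrt_le_iff.2 ⟨hκ, ?_⟩
      simp only [norm_mul, mul_pow, Complex.norm_real, Real.norm_eq_abs, sq_abs]
      rw [← Finset.mul_sum, div_pow, hN, Real.sq_sqrt hpos.le, div_mul_eq_mul_div,
        div_le_iff₀ hpos]
      exact mul_le_mul_of_nonneg_left (by linarith) (sq_nonneg κ)
    refine le_trans ?_ (add_le_add hw1 hw2)
    simp only [cnorm_eq_norm_toLp]
    exact norm_add_le (WithLp.toLp 2 fun k => ((g k : ℝ) : ℂ) * z k)
      (WithLp.toLp 2 fun k => ((κ / N : ℝ) : ℂ) * z k)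
  · intro y
    simp only [_root_.add_apply, _root_.sum_apply, _root_.smul_apply,
      ContinuousLinearMap.comp_apply, ContinuousLinearMap.proj_apply, innerSL_apply_apply,
      Complex.inner, smul_eq_mul, nsmul_eq_mul, Complex.re_sum, Finset.mul_sum,
      ← Finset.sum_add_distrib]
    refine Finset.sum_congr rfl fun k _ => ?_
    simp [← hN]
    field_simp
    ring

lemma le_subsetFunctional {ρ ε : ℝ} (hη : 0 ≤ η) (hδ : 0 ≤ δ) (hτ : 0 ≤ τ) (hε : 0 ≤ ε)
    (hρm : 0 ≤ ρ * m) (hκ : κ = ε * Real.sqrt (ρ * m)) {z : Fin m → ℂ} {S : Finset (Fin m)}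
    (hS : ρ * m ≤ S.card)
    (hz : cnorm (fun k => z k * if k ∈ S then 1 else 0) ≤ ε * cnorm z) :
    ρ * m * τ ≤ subsetFunctional τ η κ δ z := by
  set X := ∑ k, smoothHat τ η (z k) with hX
  have hX0 : 0 ≤ X := Finset.sum_nonneg fun k _ => smoothHat_nonneg _
  set q := Real.sqrt (ρ * m) with hq
  set p := Real.sqrt S.card with hp
  have hq0 : 0 ≤ q := Real.sqrt_nonneg _
  have hqp : q ≤ p := Real.sqrt_le_sqrt hS
  have hq2 : q ^ 2 = ρ * m := Real.sq_sqrt hρm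
  have hp2 : p ^ 2 = S.card := Real.sq_sqrt (Nat.cast_nonneg _)
  set B := ε * cnorm z with hB
  have hnorm : ∑ k ∈ S, ‖z k‖ ≤ p * B := by
    have hsq : cnorm (fun k => z k * if k ∈ S then 1 else 0) =
        Real.sqrt (∑ k ∈ S, ‖z k‖ ^ 2) := by
      have (k : Fin m) : ‖z k * if k ∈ S then 1 else 0‖ ^ 2 = if k ∈ S then ‖z k‖ ^ 2 else 0 := by
        split_ifs <;> simp
      simp only [cnorm, this, Finset.sum_ite_mem, Finset.univ_inter]
    have hcs := Real.sum_mul_le_sqrt_mul_sqrt S (fun _ => (1 : ℝ)) (fun k => ‖z k‖)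
    simp only [one_mul, one_pow, Finset.sum_const, nsmul_eq_mul, mul_one, ← hp] at hcs
    rw [← hsq] at hcs
    exact hcs.trans (mul_le_mul_of_nonneg_left hz (Real.sqrt_nonneg _))
  have hmain : p ^ 2 * τ ≤ p * B + X := by
    calc p ^ 2 * τ = ∑ _k ∈ S, τ := by rw [hp2]; simp
      _ ≤ ∑ k ∈ S, (‖z k‖ + smoothHat τ η (z k)) := Finset.sum_le_sum fun k _ => by
          linarith [sub_norm_le_smoothHat (τ := τ) hη (z k)]
      _ ≤ p * B + X := by
          rw [Finset.sum_add_distrib]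
          exact add_le_add hnorm (Finset.sum_le_sum_of_subset_of_nonneg (Finset.subset_univ S)
            fun k _ _ => smoothHat_nonneg _)
  have hqB : q ^ 2 * τ ≤ q * B + X := by
    rcases le_or_gt (q * τ) B with h | h
    · nlinarith
    · have : q * (q * τ - B) ≤ p * (p * τ - B) :=
        mul_le_mul hqp (by nlinarith) (by linarith) (hq0.trans hqp)
      linarith
  have hN : cnorm z ≤ Real.sqrt (∑ k, ‖z k‖ ^ 2 + δ) := Real.sqrt_le_sqrt (by linarith)
  have : q * B ≤ κ * Real.sqrt (∑ k, ‖z k‖ ^ 2 + δ) := by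
    rw [hκ, hB]
    have := mul_le_mul_of_nonneg_left hN (mul_nonneg hε hq0)
    linarith
  rw [subsetFunctional, ← hX, ← hq2]
  linarith

end Functional

section Expectation

variable {m : ℕ} {τ η κ δ : ℝ}

lemma max_sub_norm_le {ρ : ℝ} (hρ : 0 < ρ) (z : ℂ) :
    max (1.54 * ρ - ‖z‖) 0 ≤ 1.54 * ρ * Real.exp (-(1 / ρ ^ 2) * ‖z‖ ^ 2) := by
  refine max_le ?_ (by positivity)
  have h := one_sub_le_exp_neg_mul_sq (v := ‖z‖ / (1.54 * ρ)) (by positivity)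
  have h2 : -(1.54 ^ 2 * (‖z‖ / (1.54 * ρ)) ^ 2) = -(1 / ρ ^ 2) * ‖z‖ ^ 2 := by
    field_simp
  rw [h2] at h
  calc 1.54 * ρ - ‖z‖ = 1.54 * ρ * (1 - ‖z‖ / (1.54 * ρ)) := by field_simp
    _ ≤ _ := mul_le_mul_of_nonneg_left h (by positivity)

lemma integrable_exp_neg_mul_norm_sq (p : ℝ) (hp : 0 ≤ p) :
    Integrable (fun z : ℂ => Real.exp (-p * ‖z‖ ^ 2)) (cgaussian 1) :=
  (integrable_const (1 : ℝ)).mono' (Continuous.aestronglyMeasurable (by fun_prop))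
    (Filter.Eventually.of_forall fun z => by
      rw [Real.norm_of_nonneg (Real.exp_pos _).le, Real.exp_le_one_iff, neg_mul]
      exact neg_nonpos.2 (by positivity))

lemma integrable_smoothHat (hη : 0 < η) : Integrable (smoothHat τ η) (cgaussian 1) :=
  (integrable_const (max τ 0 + 3 / 2 * η)).mono'
    (contDiff_smoothHat hη).continuous.aestronglyMeasurable
    (Filter.Eventually.of_forall fun z => by
      rw [Real.norm_of_nonneg (smoothHat_nonneg z)]
      refine (smoothHat_le hη.le z).trans ?_
      gcongr
      linarith [norm_nonneg z])

lemma integral_smoothHat_le {ρ : ℝ} (hρ : 0 < ρ) (hη : 0 < η) :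
    ∫ z, smoothHat (1.54 * ρ) η z ∂cgaussian 1 ≤ 0.77 * ρ ^ 2 + 3 / 2 * η := by
  have hp : 0 ≤ 1 / ρ ^ 2 := by positivity
  have hint := (integrable_exp_neg_mul_norm_sq (1 / ρ ^ 2) hp).const_mul (1.54 * ρ)
  calc ∫ z, smoothHat (1.54 * ρ) η z ∂cgaussian 1
      ≤ ∫ z, (1.54 * ρ * Real.exp (-(1 / ρ ^ 2) * ‖z‖ ^ 2) + 3 / 2 * η) ∂cgaussian 1 :=
        integral_mono (integrable_smoothHat hη) (hint.add (integrable_const _)) fun z =>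
          (smoothHat_le hη.le z).trans (add_le_add_left (max_sub_norm_le hρ z) _)
    _ = 1.54 * ρ * (1 + 1 / ρ ^ 2)⁻¹ + 3 / 2 * η := by
        rw [integral_add hint (integrable_const _), integral_const_mul,
          integral_exp_neg_mul_norm_sq_cgaussian hp]
        simp
    _ ≤ _ := by
        have : (1 + 1 / ρ ^ 2)⁻¹ ≤ ρ / 2 := by
          have h2 : 1 + 1 / ρ ^ 2 = (1 + ρ ^ 2) / ρ ^ 2 := by field_simp; ring
          rw [h2, inv_div, div_le_iff₀ (by positivity)]
          nlinarith [sq_nonneg (ρ - 1), mul_nonneg hρ.le (sq_nonneg (ρ - 1))]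
        nlinarith

lemma integral_subsetFunctional_le {Ω : Type*} [MeasurableSpace Ω] {μ : Measure Ω}
    [IsProbabilityMeasure μ] {Z : Ω → Fin m → ℂ} (hZm : Measurable Z)
    (hZ : ∀ k, μ.map (fun a => Z a k) = cgaussian 1) {ρ : ℝ} (hρ : 0 < ρ) (hη : 0 < η)
    (hκ : 0 ≤ κ) (hδ : 0 < δ) :
    ∫ a, subsetFunctional (1.54 * ρ) η κ δ (Z a) ∂μ ≤
      m * (0.77 * ρ ^ 2 + 3 / 2 * η) + κ * Real.sqrt (m + δ) := by
  have hZk (k : Fin m) : Measurable fun a => Z a k := (measurable_pi_apply k).comp hZm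
  have hint1 (k : Fin m) : Integrable (fun a => smoothHat (1.54 * ρ) η (Z a k)) μ := by
    have h := integrable_smoothHat (τ := 1.54 * ρ) hη
    rw [← hZ k] at h
    exact h.comp_measurable (hZk k)
  have hint2 (k : Fin m) : Integrable (fun a => ‖Z a k‖ ^ 2) μ := by
    have h := integrable_norm_sq_cgaussian 1
    rw [← hZ k] at h
    exact h.comp_measurable (hZk k)
  have hE1 (k : Fin m) : ∫ a, smoothHat (1.54 * ρ) η (Z a k) ∂μ ≤ 0.77 * ρ ^ 2 + 3 / 2 * η := by
    rw [← integral_map (f := smoothHat (1.54 * ρ) η) (hZk k).aemeasurable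
      (contDiff_smoothHat hη).continuous.aestronglyMeasurable, hZ]
    exact integral_smoothHat_le hρ hη
  have hE2 (k : Fin m) : ∫ a, ‖Z a k‖ ^ 2 ∂μ = 1 := by
    rw [← integral_map (f := fun z : ℂ => ‖z‖ ^ 2) (hZk k).aemeasurable
      (Continuous.aestronglyMeasurable (by fun_prop)), hZ, integral_norm_sq_cgaussian zero_le_one]
  set s := Real.sqrt (m + δ) with hs
  have hs0 : 0 < s := Real.sqrt_pos.2 (by positivity)
  have hs2 : s ^ 2 = m + δ := Real.sq_sqrt (by positivity)
  have hI1 := integrable_finsetSum Finset.univ fun k _ => hint1 k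
  have hI2 := integrable_finsetSum Finset.univ fun k _ => hint2 k
  have hI3 : Integrable (fun a => κ / (2 * s) * (∑ k, ‖Z a k‖ ^ 2 + (δ + s ^ 2))) μ :=
    (hI2.add (integrable_const (δ + s ^ 2))).const_mul (κ / (2 * s))
  have hle (a : Ω) : subsetFunctional (1.54 * ρ) η κ δ (Z a) ≤
      ∑ k, smoothHat (1.54 * ρ) η (Z a k) +
        κ / (2 * s) * (∑ k, ‖Z a k‖ ^ 2 + (δ + s ^ 2)) := by
    set N := Real.sqrt (∑ k, ‖Z a k‖ ^ 2 + δ) with hN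
    have hN2 : N ^ 2 = ∑ k, ‖Z a k‖ ^ 2 + δ := Real.sq_sqrt (by positivity)
    have : N ≤ (∑ k, ‖Z a k‖ ^ 2 + (δ + s ^ 2)) / (2 * s) := by
      rw [le_div_iff₀ (by positivity), ← add_assoc, ← hN2]
      linarith [sq_nonneg (N - s)]
    have := mul_le_mul_of_nonneg_left this hκ
    rw [subsetFunctional, ← hN, div_mul_eq_mul_div, ← mul_div_assoc']
    linarith
  calc ∫ a, subsetFunctional (1.54 * ρ) η κ δ (Z a) ∂μ
      ≤ ∫ a, (∑ k, smoothHat (1.54 * ρ) η (Z a k) +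
        κ / (2 * s) * (∑ k, ‖Z a k‖ ^ 2 + (δ + s ^ 2))) ∂μ := by
        refine integral_mono_of_nonneg (Filter.Eventually.of_forall fun a => ?_) (hI1.add hI3)
          (Filter.Eventually.of_forall hle)
        exact add_nonneg (Finset.sum_nonneg fun k _ => smoothHat_nonneg _)
          (mul_nonneg hκ (Real.sqrt_nonneg _))
    _ = ∑ k, ∫ a, smoothHat (1.54 * ρ) η (Z a k) ∂μ + κ / (2 * s) * (m + (δ + s ^ 2)) := by
        rw [integral_add hI1 hI3, integral_const_mul, integral_add hI2 (integrable_const _),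
          integral_finsetSum _ fun k _ => hint1 k, integral_finsetSum _ fun k _ => hint2 k]
        simp [hE2]
    _ ≤ _ := by
        have h1 : ∑ k, ∫ a, smoothHat (1.54 * ρ) η (Z a k) ∂μ ≤
            m * (0.77 * ρ ^ 2 + 3 / 2 * η) :=
          (Finset.sum_le_sum fun k _ => hE1 k).trans (by simp [mul_add])
        have h2 : κ / (2 * s) * (m + (δ + s ^ 2)) = κ * s := by
          rw [← add_assoc, ← hs2]
          field_simp
          ring
        rw [h2]
        linarith

end Expectation

section Tail

variable {m : ℕ} {τ η κ δ : ℝ}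

/-- The continuous real-linear map `a ↦ M a`. -/
def mulVecCLM (M : Matrix (Fin m) (Fin m) ℂ) : (Fin m → ℂ) →L[ℝ] (Fin m → ℂ) :=
  LinearMap.toContinuousLinearMap (M.mulVecLin.restrictScalars ℝ)

lemma mulVecCLM_apply (M : Matrix (Fin m) (Fin m) ℂ) (a : Fin m → ℂ) :
    mulVecCLM M a = M.mulVec a := rfl

lemma fderiv_subsetFunctional_mulVec (hη : 0 < η) (hδ : 0 < δ) (hκ : 0 ≤ κ)
    (M : Matrix (Fin m) (Fin m) ℂ) (a : Fin m → ℂ) : ∃ c : Fin m → ℂ,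
      cnorm c ≤ opNorm M * (Real.sqrt m + κ) ∧
      ∀ y, fderiv ℝ (fun a => subsetFunctional τ η κ δ (M.mulVec a)) a y =
        (∑ k, c k * y k).re := by
  obtain ⟨w, f', hw, hf', happ⟩ :=
    exists_hasFDerivAt_subsetFunctional (τ := τ) hη hδ hκ (M.mulVec a)
  refine ⟨fun k => starRingEnd ℂ (Mᴴ.mulVec w k), ?_, fun y => ?_⟩
  · have : cnorm (fun k => starRingEnd ℂ (Mᴴ.mulVec w k)) = cnorm (Mᴴ.mulVec w) := by
      simp [cnorm]
    rw [this]
    exact (cnorm_conjTranspose_mulVec_le M w).trans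
      (mul_le_mul_of_nonneg_left hw (opNorm_nonneg M))
  · have h := (hf'.comp a (mulVecCLM M).hasFDerivAt).fderiv
    have h' : fderiv ℝ (fun a => subsetFunctional τ η κ δ (M.mulVec a)) a =
      f'.comp (mulVecCLM M) := h
    rw [h', ContinuousLinearMap.comp_apply, happ, mulVecCLM_apply]
    congr 1
    simp only [Matrix.mulVec, dotProduct, Finset.mul_sum, map_sum, Finset.sum_mul]
    rw [Finset.sum_comm]
    refine Finset.sum_congr rfl fun j _ => Finset.sum_congr rfl fun k _ => ?_
    simp
    ring

lemma measureReal_subsetFunctional_ge_le (hη : 0 < η) (hδ : 0 < δ) (hκ : 0 ≤ κ)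
    (M : Matrix (Fin m) (Fin m) ℂ) {r : ℝ} (hr : 0 ≤ r) :
    (cgaussianVec m 1).real {a |
      ∫ a, subsetFunctional τ η κ δ (M.mulVec a) ∂cgaussianVec m 1 + r ≤
        subsetFunctional τ η κ δ (M.mulVec a)} ≤
      Real.exp (-r ^ 2 / (opNorm M * (Real.sqrt m + κ)) ^ 2) := by
  choose c hc hcd using fderiv_subsetFunctional_mulVec (τ := τ) hη hδ hκ M
  set R := opNorm M * (Real.sqrt m + κ) with hR
  have h := measureReal_ge_le_exp (μ := cgaussianVec m 1) (integral_id_cgaussianVec m 1)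
    (F := fun a => subsetFunctional τ η κ δ (M.mulVec a))
    ((contDiff_subsetFunctional hη hδ).comp (mulVecCLM M).contDiff)
    (K := m * R) (c := R ^ 2 / 2) (fun a => ?_) (fun a => ?_) hr
  · refine h.trans (le_of_eq ?_)
    congr 2
    ring
  · have hR0 : 0 ≤ R := (Real.sqrt_nonneg _).trans (hc a)
    refine ContinuousLinearMap.opNorm_le_bound _ (by positivity) fun y => ?_
    rw [hcd]
    have hck (k : Fin m) : ‖c a k‖ ≤ R := by
      refine le_trans ?_ (hc a)
      exact Real.le_sqrt_of_sq_le
        (Finset.single_le_sum (f := fun k => ‖c a k‖ ^ 2) (fun _ _ => sq_nonneg _)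
          (Finset.mem_univ k))
    calc _ ≤ ‖∑ k, c a k * y k‖ := Complex.abs_re_le_norm _
      _ ≤ ∑ k, ‖c a k * y k‖ := norm_sum_le _ _
      _ ≤ ∑ _k : Fin m, R * ‖y‖ := Finset.sum_le_sum fun k _ => by
          rw [norm_mul]
          exact mul_le_mul (hck k) (norm_le_pi_norm y k) (norm_nonneg _) hR0
      _ = _ := by simp [mul_assoc]
  · simp_rw [hcd]
    rw [integral_re_sum_mul_sq]
    have h1 : ∑ k, ‖c a k‖ ^ 2 = cnorm (c a) ^ 2 := (Real.sq_sqrt (by positivity)).symm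
    rw [h1]
    have := pow_le_pow_left₀ (Real.sqrt_nonneg _) (hc a) 2
    exact div_le_div_of_nonneg_right this zero_le_two

end Tail

/-- Lemma 5.9.
For `ρ ∈ (0,1)`, with probability at least `1 − exp(−ρ⁴ m / (2‖C_x‖²))`, every subset
`S ⊆ {1,…,m}` with `|S| ≥ ρ m` satisfies `‖(A x) ∘ 1_S‖ > (ρ^{3/2}/32) ‖A x‖`. -/
theorem subset_lower_bound (n m : ℕ) (h : n ≤ m) (x : Fin n → ℂ) (hx : cnorm x = 1)
    (ρ : ℝ) (hρ : ρ ∈ Set.Ioo (0 : ℝ) 1) :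
    cgaussianVec m 1 {a | ∀ S : Finset (Fin m), ρ * (m : ℝ) ≤ (S.card : ℝ) →
        ρ ^ ((3 : ℝ) / 2) / 32 * cnorm ((Amat h a).mulVec x) <
          cnorm (fun k => (Amat h a).mulVec x k * if k ∈ S then 1 else 0)} ≥
      ENNReal.ofReal (1 - Real.exp (-(ρ ^ 4 * (m : ℝ)) / (2 * opNorm (Cx m x) ^ 2))) := by
  obtain ⟨hρ0, hρ1⟩ := hρ
  rcases m.eq_zero_or_pos with rfl | hm
  · simp
  have hm0 : (0 : ℝ) < m := Nat.cast_pos.2 hm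
  set L := opNorm (Cx m x) with hL
  rcases eq_or_ne L 0 with hL0 | hL0
  · simp [hL0]
  set ε : ℝ := ρ ^ ((3 : ℝ) / 2) / 32 with hε
  set κ : ℝ := ε * Real.sqrt (ρ * m) with hκ
  have hκeq : κ = ρ ^ 2 / 32 * Real.sqrt m := by
    have : ρ ^ ((3 : ℝ) / 2) * Real.sqrt ρ = ρ ^ 2 := by
      rw [Real.sqrt_eq_rpow, ← Real.rpow_add hρ0]
      norm_num
    rw [hκ, hε, Real.sqrt_mul hρ0.le, ← this]
    ring
  have hκ0 : 0 ≤ κ := by rw [hκeq]; positivity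
  set η : ℝ := 0.001 * ρ ^ 2 with hη
  have hη0 : 0 < η := by positivity
  set δ : ℝ := 0.0201 * m with hδ
  have hδ0 : 0 < δ := by positivity
  set G : (Fin m → ℂ) → ℝ := fun a => subsetFunctional (1.54 * ρ) η κ δ ((Cx m x).mulVec a)
    with hG
  have hlaw (k : Fin m) :
      (cgaussianVec m 1).map (fun a => (Cx m x).mulVec a k) = cgaussian 1 := by
    have := map_sum_mul_cgaussianVec (Cx m x k)
    rwa [sum_norm_sq_Cx_apply h, hx, one_pow] at this
  have hmean := integral_subsetFunctional_le (μ := cgaussianVec m 1)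
    (mulVecCLM (Cx m x)).continuous.measurable hlaw hρ0 hη0 hκ0 hδ0
  simp only [mulVecCLM_apply] at hmean
  have hsq : Real.sqrt m * Real.sqrt m = m := Real.mul_self_sqrt hm0.le
  have hsqrt : Real.sqrt (m + δ) = 1.01 * Real.sqrt m := by
    rw [hδ, show (m + 0.0201 * m : ℝ) = 1.01 ^ 2 * m by ring, Real.sqrt_mul (by positivity),
      Real.sqrt_sq (by norm_num)]
  set r : ℝ := 0.7369 * ρ ^ 2 * m with hr
  have hmean' : ∫ a, G a ∂cgaussianVec m 1 + r ≤ ρ * m * (1.54 * ρ) := by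
    have h1 : κ * Real.sqrt (m + δ) = 1.01 / 32 * ρ ^ 2 * m := by
      rw [hκeq, hsqrt]; linear_combination (1.01 / 32 * ρ ^ 2) * hsq
    rw [h1] at hmean
    have : 0 < ρ ^ 2 * m := by positivity
    simp only [hG, hr, hη] at hmean ⊢
    linarith
  have htail := measureReal_subsetFunctional_ge_le (τ := 1.54 * ρ) hη0 hδ0 hκ0 (Cx m x)
    (by positivity : 0 ≤ r)
  have hexp : -r ^ 2 / (L * (Real.sqrt m + κ)) ^ 2 ≤ -(ρ ^ 4 * m) / (2 * L ^ 2) := by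
    have hL2 : 0 < L ^ 2 := by positivity
    have hs0 : 0 < Real.sqrt m := Real.sqrt_pos.2 hm0
    have h1 : Real.sqrt m + κ ≤ 33 / 32 * Real.sqrt m := by
      rw [hκeq]
      nlinarith [pow_le_one₀ hρ0.le hρ1.le (n := 2)]
    have h2 : (Real.sqrt m + κ) ^ 2 ≤ (33 / 32) ^ 2 * m := by
      refine (pow_le_pow_left₀ (by positivity) h1 2).trans (le_of_eq ?_)
      rw [mul_pow, sq (Real.sqrt m), hsq]
    rw [neg_div, neg_div, neg_le_neg_iff, div_le_div_iff₀ (by positivity) (by positivity),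
      mul_pow, hr]
    have h3 := mul_le_mul_of_nonneg_left h2 (by positivity : 0 ≤ ρ ^ 4 * m * L ^ 2)
    have h4 : 0 ≤ ρ ^ 4 * m * L ^ 2 * m := by positivity
    linarith
  have hbad : MeasurableSet {a | ρ * m * (1.54 * ρ) ≤ G a} :=
    measurableSet_le measurable_const (((contDiff_subsetFunctional hη0 hδ0).continuous.comp
      (mulVecCLM (Cx m x)).continuous).measurable)
  have hprob : (cgaussianVec m 1).real {a | ρ * m * (1.54 * ρ) ≤ G a} ≤
      Real.exp (-(ρ ^ 4 * m) / (2 * L ^ 2)) :=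
    (measureReal_mono fun a (ha : ρ * m * (1.54 * ρ) ≤ G a) => hmean'.trans ha).trans
      (htail.trans (Real.exp_le_exp.2 hexp))
  have hsub : {a | ρ * m * (1.54 * ρ) ≤ G a}ᶜ ⊆
      {a | ∀ S : Finset (Fin m), ρ * (m : ℝ) ≤ (S.card : ℝ) →
        ε * cnorm ((Amat h a).mulVec x) <
          cnorm (fun k => (Amat h a).mulVec x k * if k ∈ S then 1 else 0)} := by
    intro a ha S hS
    by_contra! hle
    rw [Amat_mulVec_eq_Cx_mulVec] at hle
    exact ha (le_subsetFunctional hη0.le hδ0.le (by positivity) (by positivity) (by positivity)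
      hκ hS hle)
  refine le_trans ?_ (measure_mono hsub)
  rw [← ofReal_measureReal, measureReal_compl hbad, probReal_univ]
  exact ENNReal.ofReal_le_ofReal (sub_le_sub_left hprob 1)

end ConvPR

end
end

section
/- Let σ² > 1/2 and define, for t ∈ ℂ: ξ_{σ²}(t) := (1/(2πσ²))·exp(−|t|²/(2σ²)), ζ_{σ²}(t) := 1 − 2πσ²·ξ_{σ²}(t) = 1 − exp(−|t|²/(2σ²)), η_{σ²}(t) := 1 − 2πσ²·ξ_{σ²−1/2}(t), and ν_{σ²}(t) := 1 − (4πσ⁴/(2σ²−1))·ξ_{σ²−1/2}(t). Then for every t ∈ ℂ: (i) E_{s∼CN(0,1)}[ξ_{σ²}(t+s)] = ξ_{σ²+1/2}(t); (ii) E_{s∼CN(0,1)}[η_{σ²}(t+s)] = ζ_{σ²}(t); (iii) E_{s∼CN(0,1)}[ζ_{σ²}(s)] = 1/(2σ²+1); (iv) E_{s∼CN(0,1)}[|s|²·ζ_{σ²}(s)] = (4σ²+1)/(2σ²+1)²; (v) E_{s∼CN(0,2)}[η_{σ²}(s)] = 1/(2σ²+1); (vi) E_{s∼CN(0,1)}[(t+s)·ν_{σ²}(t+s)]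 = t·ζ_{σ²}(t). -/
open MeasureTheory ProbabilityTheory Matrix Complex
open scoped NNReal ENNReal

noncomputable section

namespace ConvPR

/-- Multiplying a real Gaussian law by a centred Gaussian bump gives a rescaled Gaussian law. -/
lemma withDensity_gaussianReal_exp (m : ℝ) {v a : ℝ≥0} (hv : v ≠ 0) (ha : a ≠ 0) :
    (gaussianReal m v).withDensity (fun x => ENNReal.ofReal (Real.exp (-x ^ 2 / (2 * a)))) =
      ENNReal.ofReal (√(a / (a + v)) * Real.exp (-m ^ 2 / (2 * (a + v)))) •
        gaussianReal (a / (a + v) * m) (a * v / (a + v)) := by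
  have ha' : (0 : ℝ) < a := by positivity
  have hv' : (0 : ℝ) < v := by positivity
  have hw : a * v / (a + v) ≠ 0 := by positivity
  rw [gaussianReal_of_var_ne_zero _ hv, gaussianReal_of_var_ne_zero _ hw,
    ← withDensity_mul _ (by fun_prop) (by fun_prop), ← withDensity_smul _ (by fun_prop)]
  congr 1
  ext x
  simp only [Pi.mul_apply, Pi.smul_apply, smul_eq_mul, gaussianPDF]
  rw [← ENNReal.ofReal_mul (gaussianPDFReal_nonneg _ _ _), ← ENNReal.ofReal_mul (by positivity)]
  congr 1
  simp only [gaussianPDFReal, NNReal.coe_div, NNReal.coe_mul, NNReal.coe_add]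
  have hs : √(2 * Real.pi * (a * v / (a + v))) = √(a / (a + v)) * √(2 * Real.pi * v) := by
    rw [← Real.sqrt_mul (by positivity)]
    congr 1
    ring
  have h0 : √((a : ℝ) / (a + v)) ≠ 0 := by positivity
  rw [hs, mul_inv, mul_mul_mul_comm, mul_inv_cancel_left₀ h0, mul_assoc, ← Real.exp_add,
    ← Real.exp_add]
  congr 2
  field_simp
  ring

/-- The law of `t + s` where the real and imaginary parts of `s` are independent `N(0, v)`. -/
def shiftedGaussian (t : ℂ) (v : ℝ≥0) : Measure ℂ :=
  Measure.map Complex.measurableEquivRealProd.symm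
    ((gaussianReal t.re v).prod (gaussianReal t.im v))

instance (t : ℂ) (v : ℝ≥0) : IsProbabilityMeasure (shiftedGaussian t v) :=
  Measure.isProbabilityMeasure_map (by fun_prop)

lemma integral_cgaussian_const_add {E : Type*} [NormedAddCommGroup E] [NormedSpace ℝ E]
    (σ2 : ℝ) (f : ℂ → E) (t : ℂ) :
    ∫ s, f (t + s) ∂cgaussian σ2 = ∫ w, f w ∂shiftedGaussian t (σ2 / 2).toNNReal := by
  have hmap : shiftedGaussian t (σ2 / 2).toNNReal = (cgaussian σ2).map (t + ·) := by
    rw [shiftedGaussian, cgaussian, Measure.map_map (by fun_prop) (by fun_prop)]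
    have h := fun y : ℝ => gaussianReal_map_const_add (μ := 0) (v := (σ2 / 2).toNNReal) y
    simp only [zero_add] at h
    rw [← h t.re, ← h t.im, Measure.map_prod_map _ _ (by fun_prop) (by fun_prop),
      Measure.map_map (by fun_prop) (by fun_prop)]
    congr 1
    funext p
    apply Complex.ext <;> simp [Complex.measurableEquivRealProd_symm_apply]
  rw [hmap, (measurableEmbedding_addLeft t).integral_map]

lemma integral_exp_smul_shiftedGaussian {E : Type*} [NormedAddCommGroup E] [NormedSpace ℝ E]
    (t : ℂ) {v a : ℝ≥0} (hv : v ≠ 0) (ha : a ≠ 0) (f : ℂ → E) :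
    ∫ w, Real.exp (-‖w‖ ^ 2 / (2 * a)) • f w ∂shiftedGaussian t v =
      (a / (a + v) * Real.exp (-‖t‖ ^ 2 / (2 * (a + v)))) •
        ∫ w, f w ∂shiftedGaussian (((a / (a + v) : ℝ) : ℂ) * t) (a * v / (a + v)) := by
  have hexp (x y : ℝ) (b : ℝ) : Real.exp (-x ^ 2 / b) * Real.exp (-y ^ 2 / b) =
      Real.exp (-‖(⟨x, y⟩ : ℂ)‖ ^ 2 / b) := by
    rw [← Real.exp_add, Complex.sq_norm, Complex.normSq_mk]
    congr 1
    ring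
  have hprod := prod_withDensity (μ := gaussianReal t.re v) (ν := gaussianReal t.im v)
    (f := fun x => ENNReal.ofReal (Real.exp (-x ^ 2 / (2 * a))))
    (g := fun x => ENNReal.ofReal (Real.exp (-x ^ 2 / (2 * a)))) (by fun_prop) (by fun_prop)
  rw [withDensity_gaussianReal_exp _ hv ha, withDensity_gaussianReal_exp _ hv ha,
    Measure.prod_smul_left, Measure.prod_smul_right, smul_smul,
    ← ENNReal.ofReal_mul (by positivity), mul_mul_mul_comm, hexp,
    Real.mul_self_sqrt (by positivity)] at hprod
  have hint := congrArg
    (fun μ => ∫ p, f (Complex.measurableEquivRealProd.symm p) ∂μ) hprod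
  rw [shiftedGaussian, shiftedGaussian, integral_map_equiv, integral_map_equiv]
  simp only [integral_smul_measure] at hint
  rw [integral_withDensity_eq_integral_toReal_smul (by fun_prop)
    (.of_forall fun p => ENNReal.mul_lt_top ENNReal.ofReal_lt_top ENNReal.ofReal_lt_top),
    ENNReal.toReal_ofReal (by positivity)] at hint
  simp only [Complex.re_ofReal_mul, Complex.im_ofReal_mul]
  refine Eq.trans ?_ hint.symm
  refine integral_congr_ae (.of_forall fun p => ?_)
  simp only [ENNReal.toReal_mul, ENNReal.toReal_ofReal (Real.exp_nonneg _), hexp]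
  rfl

lemma integral_exp_shiftedGaussian (t : ℂ) {v a : ℝ≥0} (hv : v ≠ 0) (ha : a ≠ 0) :
    ∫ w, Real.exp (-‖w‖ ^ 2 / (2 * a)) ∂shiftedGaussian t v =
      a / (a + v) * Real.exp (-‖t‖ ^ 2 / (2 * (a + v))) := by
  simpa using integral_exp_smul_shiftedGaussian t hv ha (fun _ => (1 : ℝ))

lemma memLp_id_shiftedGaussian (t : ℂ) (v : ℝ≥0) : MemLp id 2 (shiftedGaussian t v) := by
  rw [shiftedGaussian, MeasurableEquiv.memLp_map_measure_iff]
  exact memLp_re_im_iff.mp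
    ⟨(memLp_id_gaussianReal 2).comp_fst _, (memLp_id_gaussianReal 2).comp_snd _⟩

lemma integrable_id_shiftedGaussian (t : ℂ) (v : ℝ≥0) :
    Integrable (fun w => w) (shiftedGaussian t v) :=
  (memLp_id_shiftedGaussian t v).integrable one_le_two

lemma integrable_norm_sq_shiftedGaussian (t : ℂ) (v : ℝ≥0) :
    Integrable (fun w => ‖w‖ ^ 2) (shiftedGaussian t v) :=
  (memLp_id_shiftedGaussian t v).integrable_norm_pow two_ne_zero

lemma integral_id_shiftedGaussian (t : ℂ) (v : ℝ≥0) :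
    ∫ w, w ∂shiftedGaussian t v = t := by
  have h := integrable_id_shiftedGaussian t v
  have hre := reCLM.integral_comp_comm h
  have him := imCLM.integral_comp_comm h
  simp only [reCLM_apply, imCLM_apply] at hre him
  apply Complex.ext
  · rw [← hre, shiftedGaussian, integral_map_equiv]
    exact (integral_fun_fst (μ := gaussianReal t.re v) (ν := gaussianReal t.im v)
      (fun x => x)).trans (by simp)
  · rw [← him, shiftedGaussian, integral_map_equiv]
    exact (integral_fun_snd (μ := gaussianReal t.re v) (ν := gaussianReal t.im v)
      (fun x => x)).trans (by simp)

lemma integral_norm_sq_shiftedGaussian_zero (v : ℝ≥0) :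
    ∫ w, ‖w‖ ^ 2 ∂shiftedGaussian 0 v = 2 * v := by
  have hint : Integrable (fun x : ℝ => x ^ 2) (gaussianReal 0 v) :=
    (memLp_id_gaussianReal 2).integrable_sq
  have hsq : ∫ x, x ^ 2 ∂gaussianReal 0 v = v := by
    rw [← variance_fun_id_gaussianReal (μ := 0) (v := v),
      variance_of_integral_eq_zero (by fun_prop) (by simp)]
  have hnorm (p : ℝ × ℝ) : ‖Complex.measurableEquivRealProd.symm p‖ ^ 2 = p.1 ^ 2 + p.2 ^ 2 := by
    rw [Complex.sq_norm, Complex.normSq_apply, Complex.measurableEquivRealProd_symm_apply]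
    ring
  rw [shiftedGaussian, integral_map_equiv]
  simp only [hnorm, Complex.zero_re, Complex.zero_im]
  rw [integral_add (hint.comp_fst _) (hint.comp_snd _), integral_fun_fst (fun x : ℝ => x ^ 2),
    integral_fun_snd (fun x : ℝ => x ^ 2), hsq]
  simp
  ring

lemma Integrable.exp_neg_norm_sq_smul {E : Type*} [NormedAddCommGroup E] [NormedSpace ℝ E]
    {μ : Measure ℂ} {f : ℂ → E} (hf : Integrable f μ) (a : ℝ≥0) :
    Integrable (fun w => Real.exp (-‖w‖ ^ 2 / (2 * a)) • f w) μ := by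
  refine hf.bdd_smul 1 (by fun_prop) (.of_forall fun w => ?_)
  rw [Real.norm_of_nonneg (Real.exp_nonneg _), Real.exp_le_one_iff, neg_div]
  exact neg_nonpos.mpr (by positivity)

/-- Smoothing of a weight `1 - k exp(-|w|² / (2a))` against an integrable function. -/
lemma integral_one_sub_exp_smul_shiftedGaussian {E : Type*} [NormedAddCommGroup E]
    [NormedSpace ℝ E] (t : ℂ) {v a : ℝ≥0} (hv : v ≠ 0) (ha : a ≠ 0) (k : ℝ) {f : ℂ → E}
    (hf : Integrable f (shiftedGaussian t v)) :
    ∫ w, (1 - k * Real.exp (-‖w‖ ^ 2 / (2 * a))) • f w ∂shiftedGaussian t v =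
      ∫ w, f w ∂shiftedGaussian t v -
        (k * (a / (a + v) * Real.exp (-‖t‖ ^ 2 / (2 * (a + v))))) •
          ∫ w, f w ∂shiftedGaussian (((a / (a + v) : ℝ) : ℂ) * t) (a * v / (a + v)) := by
  have h := (Integrable.exp_neg_norm_sq_smul hf a).smul k
  simp only [Pi.smul_def] at h
  simp only [sub_smul, one_smul, mul_smul k]
  rw [integral_sub hf h, integral_smul, integral_exp_smul_shiftedGaussian t hv ha]

lemma integral_one_sub_exp_shiftedGaussian (t : ℂ) {v a : ℝ≥0} (hv : v ≠ 0) (ha : a ≠ 0)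
    (k : ℝ) :
    ∫ w, (1 - k * Real.exp (-‖w‖ ^ 2 / (2 * a))) ∂shiftedGaussian t v =
      1 - k * (a / (a + v) * Real.exp (-‖t‖ ^ 2 / (2 * (a + v)))) := by
  simpa using integral_one_sub_exp_smul_shiftedGaussian t hv ha k (integrable_const (1 : ℝ))

lemma zetaF_eq {σ2 : ℝ} (h : 0 < σ2) (t : ℂ) :
    zetaF σ2 t = 1 - 1 * Real.exp (-‖t‖ ^ 2 / (2 * σ2)) := by
  rw [zetaF, xiF]
  field_simp

lemma etaF_eq {σ2 a : ℝ} (h : 0 < a) (hσ : σ2 = a + 1 / 2) (t : ℂ) :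
    etaF σ2 t = 1 - σ2 / a * Real.exp (-‖t‖ ^ 2 / (2 * a)) := by
  rw [etaF, xiF, show σ2 - 1 / 2 = a by linarith]
  field_simp

lemma nuF_eq {σ2 a : ℝ} (h : 0 < a) (hσ : σ2 = a + 1 / 2) (t : ℂ) :
    nuF σ2 t = 1 - (σ2 / a) ^ 2 * Real.exp (-‖t‖ ^ 2 / (2 * a)) := by
  rw [nuF, xiF, show σ2 - 1 / 2 = a by linarith, show 2 * σ2 - 1 = 2 * a by linarith]
  field_simp
  ring

/-- Lemma C.3: Gaussian smoothing identities for `ξ, ζ, η, ν`. -/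
theorem gaussian_smoothing_identities (σ2 : ℝ) (hσ : 1 / 2 < σ2) :
    (∀ t : ℂ, (∫ s, xiF σ2 (t + s) ∂(cgaussian 1)) = xiF (σ2 + 1 / 2) t) ∧
    (∀ t : ℂ, (∫ s, etaF σ2 (t + s) ∂(cgaussian 1)) = zetaF σ2 t) ∧
    ((∫ s, zetaF σ2 s ∂(cgaussian 1)) = 1 / (2 * σ2 + 1)) ∧
    ((∫ s, ‖s‖ ^ 2 * zetaF σ2 s ∂(cgaussian 1)) = (4 * σ2 + 1) / (2 * σ2 + 1) ^ 2) ∧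
    ((∫ s, etaF σ2 s ∂(cgaussian 2)) = 1 / (2 * σ2 + 1)) ∧
    (∀ t : ℂ, (∫ s, (t + s) * ((nuF σ2 (t + s) : ℝ) : ℂ) ∂(cgaussian 1)) =
        t * ((zetaF σ2 t : ℝ) : ℂ)) := by
  have hσ0 : 0 < σ2 := by linarith
  obtain ⟨b, hb⟩ : ∃ b : ℝ≥0, (b : ℝ) = σ2 := ⟨⟨σ2, hσ0.le⟩, rfl⟩
  obtain ⟨a, ha⟩ : ∃ a : ℝ≥0, (a : ℝ) = σ2 - 1 / 2 := ⟨⟨σ2 - 1 / 2, by linarith⟩, rfl⟩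
  have ha0 : (0 : ℝ) < a := by linarith
  have hb' : b ≠ 0 := by rintro rfl; simp at hb; linarith
  have ha' : a ≠ 0 := by rintro rfl; simp at ha0
  have hσa : σ2 = a + 1 / 2 := by linarith
  have hv : (((1 : ℝ) / 2).toNNReal : ℝ) = 1 / 2 := Real.coe_toNNReal _ (by norm_num)
  have hv' : ((1 : ℝ) / 2).toNNReal ≠ 0 := by simp
  have hζ (w : ℂ) : zetaF σ2 w = 1 - 1 * Real.exp (-‖w‖ ^ 2 / (2 * b)) := by
    rw [hb, zetaF_eq hσ0]
  have centred (r : ℝ) (f : ℂ → ℝ) :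
      ∫ s, f s ∂cgaussian r = ∫ w, f w ∂shiftedGaussian 0 (r / 2).toNNReal := by
    simpa using integral_cgaussian_const_add r f 0
  refine ⟨fun t => ?_, fun t => ?_, ?_, ?_, ?_, fun t => ?_⟩
  · rw [integral_cgaussian_const_add 1 (xiF σ2) t]
    simp only [xiF, ← hb]
    rw [integral_const_mul, integral_exp_shiftedGaussian t hv' hb', hv, hb]
    field_simp
  · rw [integral_cgaussian_const_add 1 (etaF σ2) t]
    simp only [etaF_eq ha0 hσa]
    rw [integral_one_sub_exp_shiftedGaussian t hv' ha', hv, ← hσa, zetaF_eq hσ0]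
    field_simp
  · rw [centred]
    simp only [hζ]
    rw [integral_one_sub_exp_shiftedGaussian 0 hv' hb', hv, hb]
    simp
    field_simp
    ring
  · rw [centred]
    simp only [hζ, mul_comm (‖_‖ ^ 2), ← smul_eq_mul (_ - _)]
    rw [integral_one_sub_exp_smul_shiftedGaussian 0 hv' hb' 1
      (integrable_norm_sq_shiftedGaussian _ _), mul_zero, integral_norm_sq_shiftedGaussian_zero,
      integral_norm_sq_shiftedGaussian_zero]
    simp only [NNReal.coe_div, NNReal.coe_mul, NNReal.coe_add, hv, hb]
    simp
    field_simp
    ring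
  · rw [centred]
    simp only [etaF_eq ha0 hσa]
    rw [integral_one_sub_exp_shiftedGaussian 0 (by simp) ha']
    simp
    field_simp
    rw [hσa]
    ring
  · rw [integral_cgaussian_const_add 1 (fun w => w * ((nuF σ2 w : ℝ) : ℂ)) t]
    simp only [nuF_eq ha0 hσa, mul_comm _ (Complex.ofReal _), ← Complex.real_smul]
    rw [integral_one_sub_exp_smul_shiftedGaussian t hv' ha' _
      (integrable_id_shiftedGaussian _ _), integral_id_shiftedGaussian,
      integral_id_shiftedGaussian, hv, ← hσa, zetaF_eq hσ0, ← Complex.real_smul, smul_smul,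
      sub_smul, one_smul]
    congr 2
    field_simp

end ConvPR

end
end

section
/- For every real t ≥ 0, E_{s∼CN(0,1)}[ψ(t+s)] = (1/π)·∫_ℂ ψ(t+s)·e^{−|s|²} ds equals 1 − t^{−2} + t^{−2}·e^{−t²} if t > 0, and equals 0 if t = 0. -/
open MeasureTheory ProbabilityTheory Matrix Complex
open scoped NNReal ENNReal

noncomputable section

namespace ConvPR

/-- The integral against `CN(0, 1)` as a Lebesgue integral against the Gaussian density. -/
theorem integral_cgaussian_one {f : ℂ → ℂ} (hf : Measurable f) :
    ∫ s, f s ∂(cgaussian 1) =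
      ∫ p : ℝ × ℝ, (Real.pi⁻¹ * Real.exp (-(p.1 ^ 2 + p.2 ^ 2))) •
        f ((p.1 : ℂ) + (p.2 : ℂ) * Complex.I) := by
  have hv : ((1 : ℝ) / 2).toNNReal ≠ 0 := by simp
  have hm : Measurable fun p : ℝ × ℝ => (p.1 : ℂ) + (p.2 : ℂ) * Complex.I := by fun_prop
  have hd : Measurable fun p : ℝ × ℝ =>
      gaussianPDF 0 ((1 : ℝ) / 2).toNNReal p.1 * gaussianPDF 0 ((1 : ℝ) / 2).toNNReal p.2 := by
    fun_prop
  rw [cgaussian, integral_map hm.aemeasurable hf.aestronglyMeasurable,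
    gaussianReal_of_var_ne_zero 0 hv,
    prod_withDensity (measurable_gaussianPDF _ _) (measurable_gaussianPDF _ _),
    integral_withDensity_eq_integral_toReal_smul hd
      (Filter.Eventually.of_forall fun p =>
        ENNReal.mul_lt_top gaussianPDF_lt_top gaussianPDF_lt_top)]
  refine integral_congr_ae (Filter.Eventually.of_forall fun p => ?_)
  simp only [ENNReal.toReal_mul, toReal_gaussianPDF]
  congr 1
  have h2 : (((1 : ℝ) / 2).toNNReal : ℝ) = 1 / 2 := Real.coe_toNNReal _ (by norm_num)
  simp only [gaussianPDFReal, h2, sub_zero]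
  rw [mul_mul_mul_comm, ← mul_inv, Real.mul_self_sqrt (by positivity), ← Real.exp_add]
  congr 2 <;> ring

/-- Polar coordinates for the integral of a bounded function against `CN(0, 1)`. -/
theorem integral_cgaussian_one_eq_circleAverage {f : ℂ → ℂ} (hf : Measurable f) {C : ℝ}
    (hC : ∀ z, ‖f z‖ ≤ C) :
    ∫ s, f s ∂(cgaussian 1) =
      ∫ r in Set.Ioi (0 : ℝ), (2 * (r * Real.exp (-r ^ 2))) • Real.circleAverage f 0 r := by
  have hint : Integrable (fun r : ℝ => r * Real.exp (-r ^ 2)) := by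
    simpa using integrable_mul_exp_neg_mul_sq (b := 1) one_pos
  rw [integral_cgaussian_one hf, ← integral_comp_polarCoord_symm, polarCoord_target,
    Measure.volume_eq_prod]
  have hpolar (p : ℝ × ℝ) :
      p.1 • ((Real.pi⁻¹ * Real.exp (-((polarCoord.symm p).1 ^ 2 + (polarCoord.symm p).2 ^ 2))) •
        f (((polarCoord.symm p).1 : ℂ) + ((polarCoord.symm p).2 : ℂ) * Complex.I)) =
      (Real.pi⁻¹ * (p.1 * Real.exp (-p.1 ^ 2))) • f (circleMap 0 p.1 p.2) := by
    have h1 : (p.1 * Real.cos p.2) ^ 2 + (p.1 * Real.sin p.2) ^ 2 = p.1 ^ 2 := by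
      linear_combination p.1 ^ 2 * Real.cos_sq_add_sin_sq p.2
    have h2 : ((p.1 * Real.cos p.2 : ℝ) : ℂ) + ((p.1 * Real.sin p.2 : ℝ) : ℂ) * Complex.I =
        circleMap 0 p.1 p.2 := by
      simp only [circleMap, zero_add, Complex.exp_mul_I]
      push_cast
      ring
    simp only [polarCoord_symm_apply, h1, h2, smul_smul]
    congr 1
    ring
  simp only [hpolar]
  have hcm : Measurable fun p : ℝ × ℝ => circleMap 0 p.1 p.2 := by
    unfold circleMap
    fun_prop
  rw [setIntegral_prod]
  · refine setIntegral_congr_fun measurableSet_Ioi fun r _ => ?_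
    simp only
    rw [integral_smul, Real.circleAverage_eq_integral_add (-Real.pi),
      intervalIntegral.integral_comp_add_right (fun θ => f (circleMap 0 r θ)),
      ← integral_Ioc_eq_integral_Ioo, ← intervalIntegral.integral_of_le (by linarith [Real.pi_pos]),
      smul_smul]
    congr 1
    · field_simp
    · congr 1 <;> ring
  · rw [IntegrableOn, ← Measure.prod_restrict]
    have hc : IntegrableOn (fun _ : ℝ => C) (Set.Ioo (-Real.pi) Real.pi) :=
      integrableOn_const (by simp)
    refine ((hint.const_mul Real.pi⁻¹).integrableOn.mul_prod hc).mono
      (Measurable.aestronglyMeasurable (by fun_prop)) (Filter.Eventually.of_forall fun p => ?_)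
    rw [norm_smul]
    exact (mul_le_mul_of_nonneg_left ((hC _).trans (le_abs_self C)) (norm_nonneg _)).trans_eq
      (norm_mul _ _).symm

theorem measurable_psi : Measurable psi := by
  have hphase : Measurable phase := by
    unfold phase
    exact Measurable.ite (measurableSet_singleton 0) measurable_const (by fun_prop)
  exact (Complex.continuous_conj.measurable.comp hphase).pow_const 2

theorem norm_psi (z : ℂ) : ‖psi z‖ = 1 := by
  by_cases hz : z = 0 <;> simp [psi, phase, hz]

theorem psi_eq_conj_div {z : ℂ} (hz : z ≠ 0) : psi z = starRingEnd ℂ z / z := by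
  have hn : (‖z‖ : ℂ) ≠ 0 := by simpa using hz
  rw [psi, phase, if_neg hz, map_div₀, Complex.conj_ofReal, div_pow, ← Complex.conj_mul']
  have hc : starRingEnd ℂ z ≠ 0 := by simpa using hz
  field_simp

theorem psi_eq_of_mem_sphere {t r : ℝ} {w : ℂ} (hr : 0 < r) (hrt : r ≠ |t|)
    (hw : w ∈ Metric.sphere (t : ℂ) r) :
    w ≠ 0 ∧ w - t ≠ 0 ∧ psi w = (t + r ^ 2 * (w - t)⁻¹) * w⁻¹ := by
  have hn : ‖w - t‖ = r := by simpa [dist_eq_norm] using hw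
  have hwt : w - t ≠ 0 := norm_pos_iff.1 (by rwa [hn])
  have hw0 : w ≠ 0 := by
    rintro rfl
    simp at hn
    exact hrt hn.symm
  refine ⟨hw0, hwt, ?_⟩
  have hc : starRingEnd ℂ (w - t) * (w - t) = r ^ 2 := by rw [Complex.conj_mul', hn]
  rw [psi_eq_conj_div hw0, div_eq_mul_inv, ← hc, mul_assoc, mul_inv_cancel₀ hwt]
  simp

/-- The average of `ψ` over a circle centred at `t > 0` that avoids the origin. -/
theorem circleAverage_psi {t r : ℝ} (ht : 0 < t) (hr : 0 < r) (hrt : r ≠ t) :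
    Real.circleAverage psi t r = if r < t then ((1 - r ^ 2 / t ^ 2 : ℝ) : ℂ) else 0 := by
  have htc : (t : ℂ) ≠ 0 := by exact_mod_cast ht.ne'
  have hs (w : ℂ) (hw : w ∈ Metric.sphere (t : ℂ) r) :=
    psi_eq_of_mem_sphere hr (by rwa [abs_of_pos ht]) hw
  have hI1 : CircleIntegrable (fun w : ℂ => (1 - (r : ℂ) ^ 2 / t ^ 2) * (w - t)⁻¹) t r :=
    ContinuousOn.circleIntegrable hr.le
      (continuousOn_const.mul <| ContinuousOn.inv₀ (by fun_prop) fun w hw => (hs w hw).2.1)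
  have hI2 : CircleIntegrable (fun w : ℂ => (r : ℂ) ^ 2 / t * (w - t) ^ (-2 : ℤ)) t r :=
    ContinuousOn.circleIntegrable hr.le
      (continuousOn_const.mul <| ContinuousOn.zpow₀ (by fun_prop) _ fun w hw => Or.inl (hs w hw).2.1)
  have hI3 : CircleIntegrable (fun w : ℂ => (1 - (r : ℂ) ^ 2 / t ^ 2) * w⁻¹) t r :=
    ContinuousOn.circleIntegrable hr.le
      (continuousOn_const.mul <| ContinuousOn.inv₀ (by fun_prop) fun w hw => (hs w hw).1)
  have hI12 : CircleIntegrable (fun w : ℂ => (1 - (r : ℂ) ^ 2 / t ^ 2) * (w - t)⁻¹ +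
      (r : ℂ) ^ 2 / t * (w - t) ^ (-2 : ℤ)) t r := hI1.add hI2
  have hval : (∮ w in C((t : ℂ), r), w⁻¹) = if r < t then 0 else 2 * Real.pi * Complex.I := by
    split_ifs with h
    · refine Complex.circleIntegral_eq_zero_of_differentiable_on_off_countable hr.le
        Set.countable_empty (f := fun w : ℂ => w⁻¹)
        (ContinuousOn.inv₀ (by fun_prop) fun w hw => ?_) fun w hw => ?_
      · rintro rfl
        simp [abs_of_pos ht] at hw
        linarith
      · refine differentiableAt_inv ?_
        rintro rfl
        simp [abs_of_pos ht] at hw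
        linarith
    · have h0 : (0 : ℂ) ∈ Metric.ball (t : ℂ) r := by
        simpa [abs_of_pos ht] using lt_of_le_of_ne (not_lt.1 h) hrt.symm
      simpa using circleIntegral.integral_sub_inv_of_mem_ball h0
  have hsplit : (∮ w in C((t : ℂ), r), (w - t)⁻¹ • psi w) =
      ∮ w in C((t : ℂ), r), ((1 - (r : ℂ) ^ 2 / t ^ 2) * (w - t)⁻¹ +
        ((r : ℂ) ^ 2 / t) * (w - t) ^ (-2 : ℤ)) - (1 - (r : ℂ) ^ 2 / t ^ 2) * w⁻¹ := by
    refine circleIntegral.integral_congr hr.le fun w hw => ?_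
    obtain ⟨h0, h1, h2⟩ := hs w hw
    simp only [smul_eq_mul, h2, _root_.zpow_neg, zpow_ofNat]
    field_simp
    ring
  rw [Real.circleAverage_eq_circleIntegral hr.ne', hsplit,
    circleIntegral.integral_sub hI12 hI3,
    circleIntegral.integral_add hI1 hI2,
    circleIntegral.integral_const_mul, circleIntegral.integral_const_mul,
    circleIntegral.integral_const_mul, circleIntegral.integral_sub_center_inv _ hr.ne',
    circleIntegral.integral_sub_zpow_of_ne (by norm_num), hval]
  have hpi : (Real.pi : ℂ) ≠ 0 := by exact_mod_cast Real.pi_ne_zero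
  split_ifs
  · push_cast
    simp only [smul_eq_mul]
    field_simp
    ring
  · simp

theorem circleAverage_psi_zero {r : ℝ} (hr : 0 < r) : Real.circleAverage psi 0 r = 0 := by
  have h : (∮ w in C((0 : ℂ), r), (w - 0)⁻¹ • psi w) =
      ∮ w in C((0 : ℂ), r), (r : ℂ) ^ 2 * (w - 0) ^ (-3 : ℤ) := by
    refine circleIntegral.integral_congr hr.le fun w hw => ?_
    obtain ⟨h0, -, h2⟩ := psi_eq_of_mem_sphere (t := 0) hr (by simpa using hr.ne')
      (by simpa using hw)
    simp only [smul_eq_mul, h2, _root_.zpow_neg, zpow_ofNat, sub_zero, Complex.ofReal_zero]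
    field_simp
    ring
  rw [Real.circleAverage_eq_circleIntegral hr.ne', h, circleIntegral.integral_const_mul,
    circleIntegral.integral_sub_zpow_of_ne (by norm_num)]
  simp

/-- Polar coordinates around `t` for the smoothed phase. -/
theorem integral_psi_add_eq_circleAverage (t : ℂ) :
    ∫ s, psi (t + s) ∂(cgaussian 1) =
      ∫ r in Set.Ioi (0 : ℝ), (2 * (r * Real.exp (-r ^ 2))) • Real.circleAverage psi t r := by
  rw [integral_cgaussian_one_eq_circleAverage (f := fun s => psi (t + s))
    (measurable_psi.comp (measurable_const_add t)) fun z => (norm_psi _).le]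
  simp only [Real.circleAverage_def, circleMap, zero_add]

theorem integral_mul_exp_neg_sq_mul_one_sub {t : ℝ} (ht : 0 < t) :
    ∫ r in (0 : ℝ)..t, 2 * (r * Real.exp (-r ^ 2)) * (1 - r ^ 2 / t ^ 2) =
      1 - (t ^ 2)⁻¹ + (t ^ 2)⁻¹ * Real.exp (-t ^ 2) := by
  have hderiv (r : ℝ) : HasDerivAt
      (fun r : ℝ => Real.exp (-r ^ 2) * ((t ^ 2)⁻¹ - 1 + r ^ 2 / t ^ 2))
      (2 * (r * Real.exp (-r ^ 2)) * (1 - r ^ 2 / t ^ 2)) r := by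
    have h := hasDerivAt_pow 2 r
    convert! h.neg.exp.mul ((h.div_const (t ^ 2)).const_add ((t ^ 2)⁻¹ - 1)) using 1
    simp
    ring
  rw [intervalIntegral.integral_eq_sub_of_hasDerivAt (fun r _ => hderiv r)
    (Continuous.intervalIntegrable (by fun_prop) _ _), div_self (by positivity)]
  simp
  ring

/-- Lemma 5.13: the smoothed phase on the nonnegative real axis.
For `t ≥ 0`, `E_{s ∼ CN(0,1)}[ψ(t+s)] = 1 − t⁻² + t⁻² e^{−t²}` if `t > 0`, and `0` if
`t = 0`. -/
theorem smoothed_phase_real (t : ℝ) (ht : 0 ≤ t) :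
    (0 < t → (∫ s, psi ((t : ℂ) + s) ∂(cgaussian 1)) =
        (((1 - (t ^ 2)⁻¹ + (t ^ 2)⁻¹ * Real.exp (-t ^ 2) : ℝ)) : ℂ)) ∧
    (t = 0 → (∫ s, psi ((t : ℂ) + s) ∂(cgaussian 1)) = 0) := by
  refine ⟨fun h => ?_, ?_⟩
  · rw [integral_psi_add_eq_circleAverage]
    have hind : (fun r : ℝ => (2 * (r * Real.exp (-r ^ 2))) • Real.circleAverage psi t r)
        =ᵐ[volume.restrict (Set.Ioi 0)] (Set.Iio t).indicator
          fun r : ℝ => ((2 * (r * Real.exp (-r ^ 2)) * (1 - r ^ 2 / t ^ 2) : ℝ) : ℂ) := by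
      filter_upwards [ae_restrict_mem measurableSet_Ioi,
        ae_restrict_of_ae (Measure.ae_ne volume t)] with r hr hrt
      rw [circleAverage_psi h hr hrt]
      by_cases hlt : r < t <;> simp [hlt]
    rw [integral_congr_ae hind, setIntegral_indicator measurableSet_Iio, Set.Ioi_inter_Iio,
      integral_complex_ofReal, ← integral_Ioc_eq_integral_Ioo,
      ← intervalIntegral.integral_of_le ht, integral_mul_exp_neg_sq_mul_one_sub h]
  · rintro rfl
    rw [integral_psi_add_eq_circleAverage]
    refine setIntegral_eq_zero_of_forall_eq_zero fun r hr => ?_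
    rw [Complex.ofReal_zero, circleAverage_psi_zero hr, smul_zero]

end ConvPR

end
end
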